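/- arXiv:2601.07601 — 9 statements merged into one kernel-verified Lean document; each statement's English description precedes it below -/
import Mathlib

section
/- Let n ≥ 1 and let A be an n×n complex matrix. Then the spectral norm satisfies ‖A‖ ≤ 1 if and only if A has an unscaled block encoding, i.e., there exists a unitary 2n×2n complex matrix U whose top-left n×n block equals A (U_{i,j} = A_{i,j} for all 0 ≤ i, j < n). -/
/-- The spectral norm (ℓ² → ℓ² operator norm) of a complex square matrix. -/
noncomputable def matrixSpectralNormC {n : ℕ} (A : Matrix (Fin n) (Fin n) ℂ) : ℝ :=
  ‖LinearMap.toContinuousLinearMap (Matrix.toEuclideanLin A)‖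

open scoped ComplexOrder Matrix MatrixOrder Matrix.Norms.L2Operator in
theorem aux_norm_iff {n : ℕ} (A : Matrix (Fin n) (Fin n) ℂ) :
    matrixSpectralNormC A ≤ 1 ↔ ∃ C : Matrix (Fin n) (Fin n) ℂ, Aᴴ * A + Cᴴ * C = 1 := by
  have h0 : matrixSpectralNormC A = ‖A‖ := rfl
  have h1 : ‖A‖ ≤ 1 ↔ ‖star A * A‖ ≤ 1 := by
    rw [CStarRing.norm_star_mul_self, ← sq, sq_le_one_iff₀ (norm_nonneg _)]
  rw [h0, h1, CStarAlgebra.norm_le_one_iff_of_nonneg (star A * A) (star_mul_self_nonneg A),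
    Matrix.le_iff, Matrix.star_eq_conjTranspose]
  constructor
  · intro h
    obtain ⟨C, hC⟩ := CStarAlgebra.nonneg_iff_eq_star_mul_self.mp h.nonneg
    exact ⟨C, by rw [← Matrix.star_eq_conjTranspose C, ← hC]; abel⟩
  · rintro ⟨C, hC⟩
    rw [← hC, add_sub_cancel_left]
    exact Matrix.posSemidef_conjTranspose_mul_self C

def auxEquiv (n : ℕ) : Fin n ⊕ Fin n ≃ Fin (2 * n) :=
  finSumFinEquiv.trans (finCongr (two_mul n).symm)

open scoped Matrix in
theorem aux_extend {n : ℕ} (A C : Matrix (Fin n) (Fin n) ℂ) (h : Aᴴ * A + Cᴴ * C = 1) :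
    ∃ V : Matrix (Fin n ⊕ Fin n) (Fin n ⊕ Fin n) ℂ, Vᴴ * V = 1 ∧
      ∀ i j, V (Sum.inl i) (Sum.inl j) = A i j := by
  let v : Fin n ⊕ Fin n → EuclideanSpace ℂ (Fin n ⊕ Fin n) := fun j =>
    WithLp.toLp 2 (fun i => Matrix.fromBlocks A 0 C 0 i j)
  have hv : Orthonormal ℂ ((Set.range (Sum.inl : Fin n → Fin n ⊕ Fin n)).domRestrict v) := by
    rw [orthonormal_iff_ite]
    rintro ⟨a, ha⟩ ⟨b, hb⟩
    obtain ⟨i, rfl⟩ := Set.mem_range.mp ha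
    obtain ⟨j, rfl⟩ := Set.mem_range.mp hb
    have := congrFun (congrFun h i) j
    simp only [Matrix.add_apply, Matrix.mul_apply, Matrix.conjTranspose_apply,
      Matrix.one_apply] at this
    simp only [Subtype.mk.injEq, Sum.inl.injEq]
    simpa [v, PiLp.inner_apply, mul_comm, Set.domRestrict] using this
  obtain ⟨b, hb⟩ := hv.exists_orthonormalBasis_extension_of_card_eq (by simp)
  refine ⟨Matrix.of fun i j => b j i, ?_, ?_⟩
  · ext i j
    have := orthonormal_iff_ite.mp b.orthonormal i j
    simpa [Matrix.mul_apply, Matrix.one_apply, PiLp.inner_apply, mul_comm] using this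
  · intro i j
    simp [hb (Sum.inl j) ⟨j, rfl⟩, v]

theorem norm_le_one_iff_unscaled_block_encoding
    (n : ℕ) (hn : 1 ≤ n) (A : Matrix (Fin n) (Fin n) ℂ) :
    matrixSpectralNormC A ≤ 1 ↔
      ∃ U : Matrix (Fin (2 * n)) (Fin (2 * n)) ℂ,
        U ∈ Matrix.unitaryGroup (Fin (2 * n)) ℂ ∧
        ∀ i j : Fin n,
          U (Fin.castLE (by omega) i) (Fin.castLE (by omega) j) = A i j := by
  have he : ∀ i : Fin n, Fin.castLE (by omega) i = auxEquiv n (Sum.inl i) := fun i => by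
    ext; simp [auxEquiv]
  rw [aux_norm_iff]
  constructor
  · rintro ⟨C, hC⟩
    obtain ⟨V, hV, hVA⟩ := aux_extend A C hC
    refine ⟨V.submatrix (auxEquiv n).symm (auxEquiv n).symm, ?_, fun i j => ?_⟩
    · rw [Matrix.mem_unitaryGroup_iff', Matrix.star_eq_conjTranspose, Matrix.conjTranspose_submatrix,
        Matrix.submatrix_mul_equiv, hV, Matrix.submatrix_one_equiv]
    · rw [he, he]
      simp [hVA]
  · rintro ⟨U, hU, hUA⟩
    refine ⟨Matrix.of fun i j => U (auxEquiv n (Sum.inr i)) (auxEquiv n (Sum.inl j)), ?_⟩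
    rw [Matrix.mem_unitaryGroup_iff'] at hU
    ext i j
    have := congrFun (congrFun hU (auxEquiv n (Sum.inl i))) (auxEquiv n (Sum.inl j))
    simp only [Matrix.mul_apply, Matrix.star_apply, Matrix.one_apply, ← (auxEquiv n).sum_comp,
      Fintype.sum_sum_type, (auxEquiv n).injective.eq_iff, Sum.inl.injEq] at this
    simp only [Matrix.add_apply, Matrix.mul_apply, Matrix.conjTranspose_apply, Matrix.one_apply,
      Matrix.of_apply, ← this, ← hUA, he]
end

section
/- Let N ≥ 1 and let P be an N×N row-stochastic real matrix. Then P has an unscaled block encoding — i.e., there exists a unitary 2N×2N complex matrix U whose top-left N×N block equals P — if and only if P is doubly stochastic. -/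
open Matrix in
theorem aux_psd {N : ℕ} (P : Matrix (Fin N) (Fin N) ℝ)
    (hnn : ∀ i j, 0 ≤ P i j) (hrow : ∀ i, ∑ j, P i j = 1) (hcol : ∀ j, ∑ i, P i j = 1) :
    (1 - Pᵀ * P).PosSemidef := by
  refine Matrix.PosSemidef.of_dotProduct_mulVec_nonneg ?_ ?_
  · rw [Matrix.IsHermitian, Matrix.conjTranspose_eq_transpose_of_trivial]
    simp
  · intro x
    have h1 : ∀ i, (P *ᵥ x) i ^ 2 ≤ ∑ j, P i j * x j ^ 2 := by
      intro i
      have := Finset.sum_sq_le_sum_mul_sum_of_sq_le_mul Finset.univ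
        (r := fun j => P i j * x j) (f := fun j => P i j) (g := fun j => P i j * x j ^ 2)
        (fun j _ => hnn i j) (fun j _ => mul_nonneg (hnn i j) (sq_nonneg _))
        (fun j _ => le_of_eq (by ring))
      rw [hrow, one_mul] at this
      exact this
    have h2 : ∑ i, (P *ᵥ x) i ^ 2 ≤ ∑ j, x j ^ 2 := by
      refine (Finset.sum_le_sum fun i _ => h1 i).trans_eq ?_
      rw [Finset.sum_comm]
      simp [← Finset.sum_mul, hcol]
    rw [Matrix.sub_mulVec, dotProduct_sub, ← Matrix.mulVec_mulVec, Matrix.dotProduct_mulVec _ Pᵀ,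
      Matrix.vecMul_transpose]
    simp only [star_trivial, Matrix.one_mulVec, dotProduct, ← sq]
    linarith

open Matrix in
theorem aux_ext {N : ℕ} (P C : Matrix (Fin N) (Fin N) ℝ) (h : Pᵀ * P + Cᵀ * C = 1) :
    ∃ O : Matrix (Fin N ⊕ Fin N) (Fin N ⊕ Fin N) ℝ, Oᵀ * O = 1 ∧
      ∀ i j, O (Sum.inl i) (Sum.inl j) = P i j := by
  let v : Fin N ⊕ Fin N → EuclideanSpace ℝ (Fin N ⊕ Fin N) := fun k =>
    WithLp.toLp 2 (Sum.elim (fun j => Sum.elim (fun i => P i j) (fun i => C i j)) (fun _ => 0) k)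
  have hv : Orthonormal ℝ ((Set.range (Sum.inl : Fin N → Fin N ⊕ Fin N)).domRestrict v) := by
    rw [orthonormal_iff_ite]
    rintro ⟨_, a, rfl⟩ ⟨_, b, rfl⟩
    have := congrFun (congrFun h a) b
    simp [Matrix.mul_apply, Matrix.one_apply] at this
    have h2 : inner ℝ (v (Sum.inl a)) (v (Sum.inl b)) = if a = b then (1 : ℝ) else 0 := by
      rw [← this]
      simp [v, PiLp.inner_apply, Fintype.sum_sum_type, mul_comm]
    refine h2.trans ?_
    by_cases hab : a = b <;> simp [hab, Subtype.ext_iff]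
  obtain ⟨b, hb⟩ := hv.exists_orthonormalBasis_extension_of_card_eq (by simp)
  refine ⟨Matrix.of fun i j => b j i, ?_, ?_⟩
  · ext i j
    have := orthonormal_iff_ite.1 b.orthonormal i j
    rw [Matrix.one_apply, ← this]
    simp only [PiLp.inner_apply, Matrix.mul_apply, Matrix.transpose_apply, Matrix.of_apply]
    simp [mul_comm]
  · intro i j
    simp [hb (Sum.inl j) ⟨j, rfl⟩, v]

open Matrix in
theorem aux_fwd {N : ℕ} (P : Matrix (Fin N) (Fin N) ℝ) (hrow : ∀ i, ∑ j, P i j = 1)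
    (W : Matrix (Fin N ⊕ Fin N) (Fin N ⊕ Fin N) ℂ) (hW : W * Wᴴ = 1)
    (hP : ∀ i j, W (Sum.inl i) (Sum.inl j) = (P i j : ℂ)) : ∀ j, ∑ i, P i j = 1 := by
  let v : Fin N ⊕ Fin N → ℂ := Sum.elim 1 0
  have h1 : (v ᵥ* W) ⬝ᵥ star (v ᵥ* W) = N := by
    rw [Matrix.star_vecMul, ← Matrix.dotProduct_mulVec, Matrix.mulVec_mulVec, hW]
    simp [v, dotProduct]
  have h2 : ∑ k, ‖(v ᵥ* W) k‖ ^ 2 = (N : ℝ) := by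
    have : ((∑ k, ‖(v ᵥ* W) k‖ ^ 2 : ℝ) : ℂ) = (N : ℂ) := by
      rw [← h1]
      simp [dotProduct, Complex.mul_conj, Complex.normSq_eq_norm_sq]
    exact_mod_cast this
  have h3 : ∀ j, ‖(v ᵥ* W) (Sum.inl j)‖ ^ 2 = (∑ i, P i j) ^ 2 := by
    intro j
    have : (v ᵥ* W) (Sum.inl j) = ((∑ i, P i j : ℝ) : ℂ) := by
      simp [Matrix.vecMul, dotProduct, v, hP]
    rw [this, Complex.norm_real, Real.norm_eq_abs, sq_abs]
  have h4 : ∑ j, (∑ i, P i j) ^ 2 ≤ (N : ℝ) := by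
    rw [← h2, Fintype.sum_sum_type]
    simp only [h3]
    have : 0 ≤ ∑ k, ‖(v ᵥ* W) (Sum.inr k)‖ ^ 2 := Finset.sum_nonneg fun _ _ => sq_nonneg _
    linarith
  have h5 : ∑ j, ∑ i, P i j = (N : ℝ) := by
    rw [Finset.sum_comm]; simp [hrow]
  have h6 : ∑ j, ((∑ i, P i j) - 1) ^ 2 = ∑ j, (∑ i, P i j) ^ 2 - 2 * ∑ j, ∑ i, P i j + N := by
    simp [sub_sq, Finset.sum_add_distrib, Finset.sum_sub_distrib, Finset.mul_sum]
  have h7 : ∑ j, ((∑ i, P i j) - 1) ^ 2 = 0 :=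
    le_antisymm (by linarith) (Finset.sum_nonneg fun _ _ => sq_nonneg _)
  intro j
  have := (Finset.sum_eq_zero_iff_of_nonneg (fun _ _ => sq_nonneg _)).1 h7 j (Finset.mem_univ _)
  have := pow_eq_zero_iff (two_ne_zero) |>.1 this
  linarith

theorem stochastic_unscaled_block_encoding_iff_doublyStochastic
    (N : ℕ) (hN : 1 ≤ N) (P : Matrix (Fin N) (Fin N) ℝ)
    (hnn : ∀ i j, 0 ≤ P i j) (hrow : ∀ i, ∑ j, P i j = 1) :
    (∃ U : Matrix (Fin (2 * N)) (Fin (2 * N)) ℂ,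
        U ∈ Matrix.unitaryGroup (Fin (2 * N)) ℂ ∧
        ∀ i j : Fin N,
          U (Fin.castLE (by omega) i) (Fin.castLE (by omega) j) = (P i j : ℂ)) ↔
      (∀ j, ∑ i, P i j = 1) := by
  let e : Fin N ⊕ Fin N ≃ Fin (2 * N) := finSumFinEquiv.trans (finCongr (two_mul N).symm)
  have he : ∀ i : Fin N, Fin.castLE (by omega) i = e (Sum.inl i) := fun i => by
    ext; simp [e]
  constructor
  · rintro ⟨U, hU, hP⟩
    refine aux_fwd P hrow (U.submatrix e e) ?_ ?_
    · rw [Matrix.conjTranspose_submatrix, Matrix.submatrix_mul_equiv,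
        ← Matrix.star_eq_conjTranspose, Matrix.mem_unitaryGroup_iff.1 hU]
      simp
    · intro i j
      rw [← hP, he, he]; rfl
  · intro hcol
    obtain ⟨C, hC⟩ : ∃ C : Matrix (Fin N) (Fin N) ℝ, 1 - P.transpose * P = C.transpose * C := by
      open scoped MatrixOrder in
      have h := Matrix.nonneg_iff_posSemidef.2 (aux_psd P hnn hrow hcol)
      obtain ⟨C, hC⟩ := CStarAlgebra.nonneg_iff_eq_star_mul_self.1 h
      exact ⟨C, by rw [hC, Matrix.star_eq_conjTranspose, Matrix.conjTranspose_eq_transpose_of_trivial]⟩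
    obtain ⟨O, hO, hOP⟩ := aux_ext P C (by rw [← hC]; simp)
    refine ⟨(O.map Complex.ofReal).submatrix e.symm e.symm, ?_, ?_⟩
    · rw [Matrix.mem_unitaryGroup_iff', Matrix.star_eq_conjTranspose,
        Matrix.conjTranspose_submatrix, Matrix.submatrix_mul_equiv]
      have h1 : (O.map Complex.ofReal).conjTranspose = O.transpose.map Complex.ofReal := by
        ext i j; simp
      have h2 := congrArg (fun M => Matrix.map M Complex.ofRealHom) hO
      simp only [Matrix.map_mul] at h2
      have h3 : O.transpose.map Complex.ofReal * O.map Complex.ofReal = 1 := by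
        refine h2.trans ?_
        simp
      rw [h1, h3]; simp
    · intro i j
      rw [he, he]; simp [hOP]
end

section
/- Let N ≥ 1, let P be an N×N real matrix with nonnegative entries, and fix an index 0 ∈ {1,…,N}. Let U be a complex matrix indexed by pairs (a,b) with a,b ∈ {1,…,N}, whose columns at indices (0,i) are given by U_{(a,b),(0,i)} = √(P_{i,a}) if b = i and 0 otherwise, for every i. Let 𝔽 be the swap matrix, 𝔽_{(a,b),(c,d)} = 1 if (a,b) = (d,c) and 0 otherwise. Then for all i, j, the ((0,i),(0,j)) entry of Uᴴ 𝔽 U equals √(P_{i,j} · P_{j,i}), i.e., Uᴴ 𝔽 U block encodes the symmetrised discriminant D of P. -/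
open Matrix

theorem blockEncode_symmetrised_discriminant
    (N : ℕ) (hN : 1 ≤ N) (P : Matrix (Fin N) (Fin N) ℝ)
    (hnn : ∀ i j, 0 ≤ P i j) (z : Fin N)
    (U F : Matrix (Fin N × Fin N) (Fin N × Fin N) ℂ)
    (hU : ∀ a b i : Fin N,
      U (a, b) (z, i) = if b = i then (Real.sqrt (P i a) : ℂ) else 0)
    (hF : ∀ a b c d : Fin N,
      F (a, b) (c, d) = if (a, b) = (d, c) then 1 else 0) :
    ∀ i j : Fin N,
      (Uᴴ * F * U) (z, i) (z, j) = (Real.sqrt (P i j * P j i) : ℂ) := by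
  intro i j
  have h1 : ∀ a b : Fin N, (F * U) (a, b) (z, j) = U (b, a) (z, j) := by
    intro a b
    rw [Matrix.mul_apply, Finset.sum_eq_single (b, a)]
    · simp [hF]
    · rintro ⟨c, d⟩ _ hne
      rw [hF, if_neg, zero_mul]
      intro h
      apply hne
      simp only [Prod.mk.injEq] at h ⊢
      exact ⟨h.2.symm, h.1.symm⟩
    · intro h
      exact absurd (Finset.mem_univ _) h
  rw [Matrix.mul_assoc, Matrix.mul_apply, Finset.sum_eq_single (j, i)]
  · rw [h1, Matrix.conjTranspose_apply, hU, hU, if_pos rfl, if_pos rfl,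
      Real.sqrt_mul (hnn i j)]
    simp
  · rintro ⟨a, b⟩ _ hne
    rw [h1, Matrix.conjTranspose_apply, hU, hU]
    by_cases hb : b = i
    · by_cases ha : a = j
      · exact absurd (by rw [ha, hb]) hne
      · simp [ha]
    · simp [hb]
  · intro h
    exact absurd (Finset.mem_univ _) h
end

section
/- Let G be a finite group and μ : G → ℝ a probability distribution on G (μ(x) ≥ 0 for all x and Σ_{x∈G} μ(x) = 1), and let P be the Markov chain over G defined by P_{g, xg} = μ(x) for all g, x ∈ G (equivalently P_{g,h} = μ(h g⁻¹)). Let U be a complex matrix indexed by pairs (a,b) ∈ G × G whose columns at indices (1, g) (where 1 is the identity of G) are given by U_{(a,b),(1,g)} = √(μ(a g⁻¹)) if b = g and 0 otherwise. Let R be the permutation matrix of the bijection r(a,b) = (a b⁻¹ a, a) of G × G, i.e., R_{(c,d),(a,b)} = 1 if (c,d) = (a b⁻¹ a, a) and 0 otherwise. Then for all g, h ∈ G, the ((1,h),(1,g)) entry of Uᴴ Rᴴ U equals μ(g h⁻¹) = P_{h,g}; that is, Uᴴ Rᴴ U block encodes P. -/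
open Matrix

theorem group_markov_chain_block_encoding
    (G : Type*) [Group G] [Fintype G] [DecidableEq G]
    (mu : G → ℝ) (hmunn : ∀ x, 0 ≤ mu x) (hmusum : ∑ x, mu x = 1)
    (P : G → G → ℝ) (hP : ∀ g h, P g h = mu (h * g⁻¹))
    (U R : Matrix (G × G) (G × G) ℂ)
    (hU : ∀ a b g : G,
      U (a, b) ((1 : G), g) =
        if b = g then (Real.sqrt (mu (a * g⁻¹)) : ℂ) else 0)
    (hR : ∀ c d a b : G,
      R (c, d) (a, b) = if (c, d) = (a * b⁻¹ * a, a) then 1 else 0) :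
    ∀ g h : G,
      (Uᴴ * Rᴴ * U) ((1 : G), h) ((1 : G), g) = (P h g : ℂ) := by
  intro g h
  have h1 : ∀ c d : G, (Uᴴ * Rᴴ) ((1 : G), h) (c, d) =
      if c = d * h⁻¹ * d then (Real.sqrt (mu (d * h⁻¹)) : ℂ) else 0 := by
    intro c d
    rw [Matrix.mul_apply, Finset.sum_eq_single (d, h)]
    · simp [Matrix.conjTranspose_apply, hU, hR]
    · rintro ⟨a, b⟩ _ hne
      simp only [Matrix.conjTranspose_apply, hU, hR]
      by_cases hb : b = h
      · have ha : ¬ d = a := fun e => hne (by rw [e, hb])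
        simp [ha]
      · simp [hb]
    · simp
  rw [Matrix.mul_apply, Finset.sum_eq_single (g * h⁻¹ * g, g)]
  · rw [h1, hU, hP]
    simp only [if_true, mul_inv_cancel_right]
    rw [← Complex.ofReal_mul, Real.mul_self_sqrt (hmunn _)]
  · rintro ⟨c, d⟩ _ hne
    rw [h1, hU]
    by_cases hd : d = g
    · have hc : ¬ c = d * h⁻¹ * d := fun e => hne (by rw [e, hd])
      simp [hc]
    · simp [hd]
  · simp
end

section
/- Let N ≥ 1, let μ be the Haar probability measure on the compact topological group U(N) of N×N unitary complex matrices, let e₀ be a fixed standard basis vector of ℂ^N, and let ψ ∈ ℂ^N be a unit vector. Then ∫_{U(N)} |⟨ψ, U e₀⟩|⁴ dμ(U) = 2/(N(N+1)). Consequently the variance of |⟨ψ, U e₀⟩|² equals 2/(N(N+1)) − 1/N², which tends to 0 as N → ∞. -/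
open MeasureTheory

lemma aux_exists_unitary {N : ℕ} (φ : Fin N → ℂ) (hφ : ∑ i, norm (φ i) ^ 2 = 1) (k : Fin N) :
    ∃ V : Matrix.unitaryGroup (Fin N) ℂ, ∀ i,
      (V : Matrix (Fin N) (Fin N) ℂ) k i = (starRingEnd ℂ) (φ i) := by
  have hn : ‖(WithLp.toLp 2 φ : EuclideanSpace ℂ (Fin N))‖ = 1 := by
    rw [EuclideanSpace.norm_eq]; simp [hφ]
  obtain ⟨b, hb⟩ := Orthonormal.exists_orthonormalBasis_extension_of_card_eq
    (𝕜 := ℂ) (E := EuclideanSpace ℂ (Fin N)) (ι := Fin N) (by simp)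
    (v := fun _ => WithLp.toLp 2 φ) (s := {k}) (by
      constructor
      · intro i; simpa using hn
      · intro i j hij; exact absurd (Subsingleton.elim i j) hij)
  refine ⟨⟨Matrix.of fun i j => (starRingEnd ℂ) (b i j), ?_⟩, ?_⟩
  · rw [Matrix.mem_unitaryGroup_iff]
    ext i l
    have := orthonormal_iff_ite.mp b.orthonormal i l
    simp only [PiLp.inner_apply, RCLike.inner_apply] at this
    simp only [Matrix.mul_apply, Matrix.star_apply, Matrix.of_apply, Matrix.one_apply]
    rw [← this]
    refine Finset.sum_congr rfl fun x _ => ?_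
    simp [mul_comm]
  · intro i
    simp [hb k rfl]

lemma aux_inv {N : ℕ}
    [MeasurableSpace (Matrix.unitaryGroup (Fin N) ℂ)]
    [BorelSpace (Matrix.unitaryGroup (Fin N) ℂ)]
    (μ : Measure (Matrix.unitaryGroup (Fin N) ℂ))
    [μ.IsHaarMeasure]
    (e₀ : Fin N) (φ : Fin N → ℂ) (hφ : ∑ i, norm (φ i) ^ 2 = 1) (k : Fin N) (p : ℕ) :
    ∫ U : Matrix.unitaryGroup (Fin N) ℂ,
        norm (∑ i, (starRingEnd ℂ) (φ i) * (U : Matrix (Fin N) (Fin N) ℂ) i e₀) ^ p ∂μ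
      = ∫ U : Matrix.unitaryGroup (Fin N) ℂ,
        norm ((U : Matrix (Fin N) (Fin N) ℂ) k e₀) ^ p ∂μ := by
  obtain ⟨V, hV⟩ := aux_exists_unitary φ hφ k
  rw [← integral_mul_left_eq_self (μ := μ) (fun U : Matrix.unitaryGroup (Fin N) ℂ =>
    norm ((U : Matrix (Fin N) (Fin N) ℂ) k e₀) ^ p) V]
  simp [Matrix.mul_apply, hV]

lemma aux_pt (a b : ℂ) :
    norm (a + b) ^ 4 + norm (a - b) ^ 4 + norm (a + Complex.I * b) ^ 4
      + norm (a - Complex.I * b) ^ 4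
      = 4 * (norm a ^ 4 + norm b ^ 4 + 4 * (norm a ^ 2 * norm b ^ 2)) := by
  have h (z : ℂ) : norm z ^ 4 = (z.re ^ 2 + z.im ^ 2) ^ 2 := by
    rw [show norm z ^ 4 = (norm z ^ 2) ^ 2 by ring, Complex.sq_norm, Complex.normSq_apply]; ring
  simp only [h, Complex.sq_norm, Complex.normSq_apply]
  simp
  ring

lemma aux_cont {N : ℕ} (i j : Fin N) :
    Continuous fun U : Matrix.unitaryGroup (Fin N) ℂ => (U : Matrix (Fin N) (Fin N) ℂ) i j :=
  continuous_subtype_val.matrix_elem i j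

lemma aux_int {N : ℕ}
    [MeasurableSpace (Matrix.unitaryGroup (Fin N) ℂ)]
    [BorelSpace (Matrix.unitaryGroup (Fin N) ℂ)]
    (μ : Measure (Matrix.unitaryGroup (Fin N) ℂ))
    [IsProbabilityMeasure μ] (e₀ i j : Fin N) (p q : ℕ) (c d : ℂ) :
    Integrable (fun U : Matrix.unitaryGroup (Fin N) ℂ =>
      norm (c * (U : Matrix (Fin N) (Fin N) ℂ) i e₀ + d * (U : Matrix (Fin N) (Fin N) ℂ) j e₀) ^ p
       * norm ((U : Matrix (Fin N) (Fin N) ℂ) j e₀) ^ q) μ := by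
  have h1 := aux_cont i e₀
  have h2 := aux_cont j e₀
  refine Integrable.of_bound (C := (norm c + norm d) ^ p * 1 ^ q)
    (Continuous.aestronglyMeasurable
      ((((continuous_const.mul h1).add (continuous_const.mul h2)).norm.pow p).mul (h2.norm.pow q))) (Filter.Eventually.of_forall fun U => ?_)
  have e1 := entry_norm_bound_of_unitary U.2 i e₀
  have e2 := entry_norm_bound_of_unitary U.2 j e₀
  rw [Real.norm_of_nonneg (by positivity)]
  gcongr
  refine (norm_add_le _ _).trans ?_
  rw [norm_mul, norm_mul]
  have := mul_le_mul_of_nonneg_left e1 (norm_nonneg c)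
  have := mul_le_mul_of_nonneg_left e2 (norm_nonneg d)
  linarith

lemma aux_pair {N : ℕ}
    [MeasurableSpace (Matrix.unitaryGroup (Fin N) ℂ)]
    [BorelSpace (Matrix.unitaryGroup (Fin N) ℂ)]
    (μ : Measure (Matrix.unitaryGroup (Fin N) ℂ))
    [μ.IsHaarMeasure]
    (e₀ i j : Fin N) (hij : i ≠ j) (w : ℂ) (hw : norm w = 1) (k : Fin N) :
    ∫ U : Matrix.unitaryGroup (Fin N) ℂ,
        norm ((U : Matrix (Fin N) (Fin N) ℂ) i e₀ + w * (U : Matrix (Fin N) (Fin N) ℂ) j e₀) ^ 4 ∂μ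
      = 4 * ∫ U : Matrix.unitaryGroup (Fin N) ℂ,
        norm ((U : Matrix (Fin N) (Fin N) ℂ) k e₀) ^ 4 ∂μ := by
  have hs : ((Real.sqrt 2)⁻¹) ^ 2 = (1 / 2 : ℝ) := by
    rw [inv_pow, Real.sq_sqrt (by norm_num)]; norm_num
  set s : ℝ := (Real.sqrt 2)⁻¹ with hsd
  have hs0 : 0 ≤ s := by positivity
  let φ : Fin N → ℂ := Pi.single i (s : ℂ) + Pi.single j (s * (starRingEnd ℂ) w)
  have hsum (g : Fin N → ℂ → ℝ) (hg : ∀ l, g l 0 = 0) :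
      ∑ l, g l (φ l) = g i s + g j (s * (starRingEnd ℂ) w) := by
    rw [Fintype.sum_eq_add i j hij]
    · simp [φ, hij, hij.symm]
    · rintro l ⟨h1, h2⟩; simp [φ, h1, h2, hg]
  have hφ : ∑ l, norm (φ l) ^ 2 = 1 := by
    rw [hsum (fun _ z => norm z ^ 2) (by simp)]
    simp [hw, hs]
    norm_num
  rw [← aux_inv μ e₀ φ hφ k 4, ← integral_const_mul]
  refine integral_congr_ae (Filter.Eventually.of_forall fun U => ?_)
  have : ∑ l, (starRingEnd ℂ) (φ l) * (U : Matrix (Fin N) (Fin N) ℂ) l e₀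
     = s * ((U : Matrix (Fin N) (Fin N) ℂ) i e₀ + w * (U : Matrix (Fin N) (Fin N) ℂ) j e₀) := by
    rw [Fintype.sum_eq_add i j hij]
    · simp [φ, hij, hij.symm]; ring
    · rintro l ⟨h1, h2⟩; simp [φ, h1, h2]
  simp only [this, norm_mul, Complex.norm_real, mul_pow, Real.norm_of_nonneg hs0]
  rw [show s ^ 4 = (s ^ 2) ^ 2 by ring, hs]
  ring

lemma aux_col {N : ℕ} (U : Matrix.unitaryGroup (Fin N) ℂ) (e₀ : Fin N) :
    ∑ i, norm ((U : Matrix (Fin N) (Fin N) ℂ) i e₀) ^ 2 = 1 := by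
  have h := congrFun (congrFun (Matrix.mem_unitaryGroup_iff'.mp U.2) e₀) e₀
  simp only [Matrix.mul_apply, Matrix.star_apply, Matrix.one_apply_eq] at h
  have h2 : ((∑ i, norm ((U : Matrix (Fin N) (Fin N) ℂ) i e₀) ^ 2 : ℝ) : ℂ) = 1 := by
    rw [← h]; push_cast
    refine Finset.sum_congr rfl fun x _ => ?_
    exact (Complex.conj_mul' _).symm
  exact_mod_cast h2

lemma aux_single {N : ℕ}
    [MeasurableSpace (Matrix.unitaryGroup (Fin N) ℂ)]
    [BorelSpace (Matrix.unitaryGroup (Fin N) ℂ)]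
    (μ : Measure (Matrix.unitaryGroup (Fin N) ℂ))
    [μ.IsHaarMeasure] (e₀ i k : Fin N) (p : ℕ) :
    ∫ U : Matrix.unitaryGroup (Fin N) ℂ,
        norm ((U : Matrix (Fin N) (Fin N) ℂ) i e₀) ^ p ∂μ
      = ∫ U : Matrix.unitaryGroup (Fin N) ℂ,
        norm ((U : Matrix (Fin N) (Fin N) ℂ) k e₀) ^ p ∂μ := by
  rw [← aux_inv μ e₀ (Pi.single i 1) ?_ k p]
  · refine integral_congr_ae (Filter.Eventually.of_forall fun U => ?_)
    simp only
    rw [Fintype.sum_eq_single i]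
    · simp
    · intro l hl; simp [hl]
  · rw [Fintype.sum_eq_single i]
    · simp
    · intro l hl; simp [hl]

lemma aux_cross {N : ℕ}
    [MeasurableSpace (Matrix.unitaryGroup (Fin N) ℂ)]
    [BorelSpace (Matrix.unitaryGroup (Fin N) ℂ)]
    (μ : Measure (Matrix.unitaryGroup (Fin N) ℂ))
    [μ.IsHaarMeasure] [IsProbabilityMeasure μ] (e₀ i j k : Fin N) (hij : i ≠ j) :
    ∫ U : Matrix.unitaryGroup (Fin N) ℂ,
        norm ((U : Matrix (Fin N) (Fin N) ℂ) i e₀) ^ 2 *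
        norm ((U : Matrix (Fin N) (Fin N) ℂ) j e₀) ^ 2 ∂μ
      = (∫ U : Matrix.unitaryGroup (Fin N) ℂ,
        norm ((U : Matrix (Fin N) (Fin N) ℂ) k e₀) ^ 4 ∂μ) / 2 := by
  have hI (w : ℂ) : Integrable (fun U : Matrix.unitaryGroup (Fin N) ℂ =>
      norm ((U : Matrix (Fin N) (Fin N) ℂ) i e₀ + w * (U : Matrix (Fin N) (Fin N) ℂ) j e₀) ^ 4) μ := by
    simpa using aux_int μ e₀ i j 4 0 1 w
  have hS (i : Fin N) : Integrable (fun U : Matrix.unitaryGroup (Fin N) ℂ =>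
      norm ((U : Matrix (Fin N) (Fin N) ℂ) i e₀) ^ 4) μ := by
    simpa using aux_int μ e₀ i i 4 0 1 0
  have hC : Integrable (fun U : Matrix.unitaryGroup (Fin N) ℂ =>
      norm ((U : Matrix (Fin N) (Fin N) ℂ) i e₀) ^ 2 *
        norm ((U : Matrix (Fin N) (Fin N) ℂ) j e₀) ^ 2) μ := by
    simpa using aux_int μ e₀ i j 2 2 1 0
  have key := integral_congr_ae (μ := μ) (Filter.Eventually.of_forall
    fun U : Matrix.unitaryGroup (Fin N) ℂ => (by
      have := aux_pt ((U : Matrix (Fin N) (Fin N) ℂ) i e₀) ((U : Matrix (Fin N) (Fin N) ℂ) j e₀)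
      simpa only [one_mul, neg_mul, ← sub_eq_add_neg] using this :
      norm ((U : Matrix (Fin N) (Fin N) ℂ) i e₀ + 1 * (U : Matrix (Fin N) (Fin N) ℂ) j e₀) ^ 4
      + norm ((U : Matrix (Fin N) (Fin N) ℂ) i e₀ + (-1) * (U : Matrix (Fin N) (Fin N) ℂ) j e₀) ^ 4
      + norm ((U : Matrix (Fin N) (Fin N) ℂ) i e₀
          + Complex.I * (U : Matrix (Fin N) (Fin N) ℂ) j e₀) ^ 4
      + norm ((U : Matrix (Fin N) (Fin N) ℂ) i e₀
          + (-Complex.I) * (U : Matrix (Fin N) (Fin N) ℂ) j e₀) ^ 4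
      = 4 * (norm ((U : Matrix (Fin N) (Fin N) ℂ) i e₀) ^ 4
        + norm ((U : Matrix (Fin N) (Fin N) ℂ) j e₀) ^ 4
        + 4 * (norm ((U : Matrix (Fin N) (Fin N) ℂ) i e₀) ^ 2
          * norm ((U : Matrix (Fin N) (Fin N) ℂ) j e₀) ^ 2))))
  rw [integral_add (((hI _).fun_add (hI _)).fun_add (hI _)) (hI _),
    integral_add ((hI _).fun_add (hI _)) (hI _), integral_add (hI _) (hI _),
    integral_const_mul, integral_add ((hS _).fun_add (hS _)) (hC.const_mul _),
    integral_add (hS _) (hS _), integral_const_mul,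
    aux_pair μ e₀ i j hij _ (by simp) k, aux_pair μ e₀ i j hij _ (by simp) k,
    aux_pair μ e₀ i j hij _ (by simp) k, aux_pair μ e₀ i j hij _ (by simp) k,
    aux_single μ e₀ i k, aux_single μ e₀ j k] at key
  linarith

lemma aux_two {N : ℕ} (hN : 1 ≤ N)
    [MeasurableSpace (Matrix.unitaryGroup (Fin N) ℂ)]
    [BorelSpace (Matrix.unitaryGroup (Fin N) ℂ)]
    (μ : Measure (Matrix.unitaryGroup (Fin N) ℂ))
    [μ.IsHaarMeasure] [IsProbabilityMeasure μ] (e₀ k : Fin N) :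
    ∫ U : Matrix.unitaryGroup (Fin N) ℂ,
        norm ((U : Matrix (Fin N) (Fin N) ℂ) k e₀) ^ 2 ∂μ = 1 / N := by
  have hS (i : Fin N) : Integrable (fun U : Matrix.unitaryGroup (Fin N) ℂ =>
      norm ((U : Matrix (Fin N) (Fin N) ℂ) i e₀) ^ 2) μ := by
    simpa using aux_int μ e₀ i i 2 0 1 0
  have key := integral_congr_ae (μ := μ) (Filter.Eventually.of_forall
    fun U : Matrix.unitaryGroup (Fin N) ℂ => aux_col U e₀)
  rw [integral_finsetSum _ (fun i _ => hS i),
    Finset.sum_congr rfl (fun i _ => aux_single μ e₀ i k 2)] at key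
  simp at key
  have : (N : ℝ) ≠ 0 := by positivity
  field_simp
  linarith

lemma aux_four {N : ℕ} (hN : 1 ≤ N)
    [MeasurableSpace (Matrix.unitaryGroup (Fin N) ℂ)]
    [BorelSpace (Matrix.unitaryGroup (Fin N) ℂ)]
    (μ : Measure (Matrix.unitaryGroup (Fin N) ℂ))
    [μ.IsHaarMeasure] [IsProbabilityMeasure μ] (e₀ k : Fin N) :
    ∫ U : Matrix.unitaryGroup (Fin N) ℂ,
        norm ((U : Matrix (Fin N) (Fin N) ℂ) k e₀) ^ 4 ∂μ = 2 / ((N : ℝ) * (N + 1)) := by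
  have hC (i j : Fin N) : Integrable (fun U : Matrix.unitaryGroup (Fin N) ℂ =>
      norm ((U : Matrix (Fin N) (Fin N) ℂ) i e₀) ^ 2 *
        norm ((U : Matrix (Fin N) (Fin N) ℂ) j e₀) ^ 2) μ := by
    simpa using aux_int μ e₀ i j 2 2 1 0
  have key := integral_congr_ae (μ := μ) (Filter.Eventually.of_forall
    fun U : Matrix.unitaryGroup (Fin N) ℂ => (by
      rw [← Finset.sum_mul_sum, aux_col U e₀, one_mul] :
      ∑ i, ∑ j, norm ((U : Matrix (Fin N) (Fin N) ℂ) i e₀) ^ 2 *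
        norm ((U : Matrix (Fin N) (Fin N) ℂ) j e₀) ^ 2 = 1))
  rw [integral_finsetSum _ (fun i _ => integrable_finsetSum _ fun j _ => hC i j)] at key
  set A := ∫ U : Matrix.unitaryGroup (Fin N) ℂ,
        norm ((U : Matrix (Fin N) (Fin N) ℂ) k e₀) ^ 4 ∂μ with hA
  have hrow (i : Fin N) : ∫ U : Matrix.unitaryGroup (Fin N) ℂ,
      ∑ j, norm ((U : Matrix (Fin N) (Fin N) ℂ) i e₀) ^ 2 *
        norm ((U : Matrix (Fin N) (Fin N) ℂ) j e₀) ^ 2 ∂μ = (N + 1) * (A / 2) := by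
    rw [integral_finsetSum _ (fun j _ => hC i j)]
    have : ∀ j, ∫ U : Matrix.unitaryGroup (Fin N) ℂ,
      norm ((U : Matrix (Fin N) (Fin N) ℂ) i e₀) ^ 2 *
        norm ((U : Matrix (Fin N) (Fin N) ℂ) j e₀) ^ 2 ∂μ = A / 2 + if i = j then A / 2 else 0 := by
      intro j
      split_ifs with h
      · subst h
        rw [add_halves, hA, ← aux_single μ e₀ i k 4]
        refine integral_congr_ae (Filter.Eventually.of_forall fun U => ?_)
        simp only
        ring
      · rw [aux_cross μ e₀ i j k h, add_zero]
    simp only [this, Finset.sum_add_distrib]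
    simp
    ring
  simp only [hrow] at key
  simp at key
  have : (N : ℝ) ≠ 0 := by positivity
  have : (N : ℝ) + 1 ≠ 0 := by positivity
  field_simp
  linarith



theorem haar_unitary_fourth_moment_and_variance
    (N : ℕ) (hN : 1 ≤ N)
    [MeasurableSpace (Matrix.unitaryGroup (Fin N) ℂ)]
    [BorelSpace (Matrix.unitaryGroup (Fin N) ℂ)]
    (μ : Measure (Matrix.unitaryGroup (Fin N) ℂ))
    [μ.IsHaarMeasure] [IsProbabilityMeasure μ]
    (e₀ : Fin N) (ψ : Fin N → ℂ) (hψ : ∑ i, norm (ψ i) ^ 2 = 1) :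
    (∫ U : Matrix.unitaryGroup (Fin N) ℂ,
        norm (∑ i, (starRingEnd ℂ) (ψ i) *
          ((U : Matrix (Fin N) (Fin N) ℂ).mulVec (Pi.single e₀ 1)) i) ^ 4 ∂μ
      = 2 / ((N : ℝ) * (N + 1))) ∧
    ((∫ U : Matrix.unitaryGroup (Fin N) ℂ,
        norm (∑ i, (starRingEnd ℂ) (ψ i) *
          ((U : Matrix (Fin N) (Fin N) ℂ).mulVec (Pi.single e₀ 1)) i) ^ 4 ∂μ)
      - (∫ U : Matrix.unitaryGroup (Fin N) ℂ,
          norm (∑ i, (starRingEnd ℂ) (ψ i) *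
            ((U : Matrix (Fin N) (Fin N) ℂ).mulVec (Pi.single e₀ 1)) i) ^ 2 ∂μ) ^ 2
      = 2 / ((N : ℝ) * (N + 1)) - 1 / (N : ℝ) ^ 2) ∧
    Filter.Tendsto (fun n : ℕ => 2 / ((n : ℝ) * (n + 1)) - 1 / (n : ℝ) ^ 2)
      Filter.atTop (nhds 0) := by
  have h4 := (aux_inv μ e₀ ψ hψ e₀ 4).trans (aux_four hN μ e₀ e₀)
  have h2 := (aux_inv μ e₀ ψ hψ e₀ 2).trans (aux_two hN μ e₀ e₀)
  simp only [Matrix.mulVec_single_one, Matrix.col_apply]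
  refine ⟨h4, ?_, ?_⟩
  · rw [h4, h2]; ring
  · have ha : Filter.Tendsto (fun n : ℕ => 1 / (n : ℝ)) Filter.atTop (nhds 0) :=
      tendsto_one_div_atTop_nhds_zero_nat
    have hb : Filter.Tendsto (fun n : ℕ => 1 / ((n : ℝ) + 1)) Filter.atTop (nhds 0) :=
      tendsto_one_div_add_atTop_nhds_zero_nat
    have := ((ha.mul hb).const_mul 2).sub (ha.pow 2)
    simp only [mul_zero, ne_eq, OfNat.ofNat_ne_zero, not_false_eq_true, zero_pow, sub_zero] at this
    refine this.congr fun n => ?_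
    rw [one_div_mul_one_div, one_div_pow, mul_one_div]
end

section
/- There exists a constant C > 0 such that for every Δ ∈ (0,1], every t ∈ (0,1) and every α ∈ (0,1), there exists a real polynomial p with degree at most C · (1/(Δt)) · log(1/α) satisfying: |p(x)| ≤ 1 for all x ∈ [−1,1]; |p(x)| ≤ α for all x ∈ [0, 1 − Δ(1+t)]; and p(x) ≥ 1/4 for all x ∈ [1 − Δ(1−t), 1]. -/
open Polynomial
lemma exists_antideriv (K : ℝ[X]) : ∃ F : ℝ[X], F.natDegree ≤ K.natDegree + 1 ∧ derivative F = K := by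
  refine ⟨∑ i ∈ Finset.range (K.natDegree + 1), monomial (i+1) (K.coeff i / (i+1)), ?_, ?_⟩
  · apply natDegree_sum_le_of_forall_le
    intro i hi
    refine (natDegree_monomial_le _).trans ?_
    simp at hi; omega
  · rw [derivative_sum]
    conv_rhs => rw [K.as_sum_range]
    apply Finset.sum_congr rfl
    intro i _
    rw [derivative_monomial]
    simp
    congr 1
    field_simp

/-- normalised primitive -/
lemma exists_step (K : ℝ[X]) (a b c : ℝ) (hK : ∀ x ∈ Set.Icc a b, 0 ≤ K.eval x)
    (hc : 0 < c) (hM : c ≤ ∫ x in a..b, K.eval x) :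
    ∃ P : ℝ[X], P.natDegree ≤ K.natDegree + 1 ∧ (∀ x ∈ Set.Icc a b, 0 ≤ P.eval x ∧ P.eval x ≤ 1) ∧
      (∀ x ∈ Set.Icc a b, P.eval x ≤ (∫ y in a..x, K.eval y) / c) ∧
      (∀ x ∈ Set.Icc a b, 1 - (∫ y in x..b, K.eval y) / c ≤ P.eval x) := by
  obtain ⟨F, hF, hd⟩ := exists_antideriv K
  have hI : ∀ u v, ∫ y in u..v, K.eval y = F.eval v - F.eval u := by
    intro u v
    apply intervalIntegral.integral_eq_sub_of_hasDerivAt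
    · intro x _; rw [← hd]; exact F.hasDerivAt x
    · exact K.continuous.intervalIntegrable _ _
  have h1 : ∀ x ∈ Set.Icc a b, 0 ≤ F.eval x - F.eval a := by
    intro x hx
    rw [← hI]
    exact intervalIntegral.integral_nonneg hx.1 (fun u hu => hK u ⟨hu.1, hu.2.trans hx.2⟩)
  have h2 : ∀ x ∈ Set.Icc a b, 0 ≤ F.eval b - F.eval x := by
    intro x hx
    rw [← hI]
    exact intervalIntegral.integral_nonneg hx.2 (fun u hu => hK u ⟨hx.1.trans hu.1, hu.2⟩)
  rw [hI] at hM
  set M := F.eval b - F.eval a with hMd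
  have hM0 : 0 < M := hc.trans_le hM
  have he : ∀ x, (C M⁻¹ * (F - C (F.eval a))).eval x = (F.eval x - F.eval a) / M := by
    intro x; simp [div_eq_inv_mul]
  refine ⟨C M⁻¹ * (F - C (F.eval a)), ?_, ?_, ?_, ?_⟩
  · refine (natDegree_C_mul_le _ _).trans ?_
    rwa [natDegree_sub_C]
  · intro x hx
    rw [he]
    refine ⟨div_nonneg (h1 x hx) hM0.le, ?_⟩
    rw [div_le_one hM0]
    linarith [h2 x hx]
  · intro x hx
    rw [he, hI]
    exact div_le_div_of_nonneg_left (h1 x hx) hc hM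
  · intro x hx
    rw [he, hI]
    have := div_le_div_of_nonneg_left (h2 x hx) hc hM
    have h3 : (F.eval x - F.eval a) / M = 1 - (F.eval b - F.eval x) / M := by
      field_simp; rw [hMd]; ring
    linarith

lemma exists_amp (m : ℕ) : ∃ A : ℝ[X], A.natDegree ≤ 2 * m + 1 ∧
    (∀ x ∈ Set.Icc (0:ℝ) 1, 0 ≤ A.eval x ∧ A.eval x ≤ 1) ∧
    (∀ x ∈ Set.Icc (0:ℝ) (1/16), A.eval x ≤ (1/3)^m) ∧
    (∀ x ∈ Set.Icc (15/16:ℝ) 1, 1/4 ≤ A.eval x) := by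
  have hev : ∀ x, ((X * (1 - X) : ℝ[X])^m).eval x = (x * (1-x))^m := by intro x; simp
  have hint : ∀ u v, IntervalIntegrable (fun x : ℝ => (x*(1-x))^m) MeasureTheory.volume u v :=
    fun u v => (by fun_prop : Continuous (fun x : ℝ => (x*(1-x))^m)).intervalIntegrable _ _
  have hnn : ∀ x ∈ Set.Icc (0:ℝ) 1, 0 ≤ x*(1-x) := fun x hx => mul_nonneg hx.1 (by linarith [hx.2])
  obtain ⟨A, h0, h1, h2, h3⟩ := exists_step ((X * (1 - X))^m) 0 1 ((3/16)^m*(1/2))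
    (by intro x hx; rw [hev]; exact pow_nonneg (hnn x hx) _) (by positivity) (by
      simp only [hev]
      have e1 := intervalIntegral.integral_add_adjacent_intervals (hint 0 (1/4)) (hint (1/4) (3/4))
      have e2 := intervalIntegral.integral_add_adjacent_intervals (hint 0 (3/4)) (hint (3/4) 1)
      have p1 : 0 ≤ ∫ x in (0:ℝ)..(1/4), (x*(1-x))^m :=
        intervalIntegral.integral_nonneg (by norm_num)
          (fun x hx => pow_nonneg (hnn x ⟨hx.1, by linarith [hx.2]⟩) _)
      have p2 : 0 ≤ ∫ x in (3/4:ℝ)..1, (x*(1-x))^m :=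
        intervalIntegral.integral_nonneg (by norm_num)
          (fun x hx => pow_nonneg (hnn x ⟨by linarith [hx.1], hx.2⟩) _)
      have p3 : ∫ x in (1/4:ℝ)..(3/4), ((3/16:ℝ))^m ≤ ∫ x in (1/4:ℝ)..(3/4), (x*(1-x))^m := by
        apply intervalIntegral.integral_mono_on (by norm_num) (by simp) (hint _ _)
        intro x hx
        apply pow_le_pow_left₀ (by norm_num)
        nlinarith [hx.1, hx.2]
      rw [intervalIntegral.integral_const] at p3
      simp only [smul_eq_mul] at p3
      linarith)
  simp only [hev] at h2 h3
  have hq : (1/16:ℝ)^m = (1/3)^m * (3/16)^m := by rw [← mul_pow]; norm_num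
  have key : ∀ I : ℝ, I ≤ (1/16:ℝ)^m * (1/16) → I / ((3/16)^m*(1/2)) ≤ (1/3)^m * (1/8) := by
    intro I hI
    rw [div_le_iff₀ (by positivity)]
    rw [hq] at hI
    linarith
  have h13 : (1/3:ℝ)^m ≤ 1 := pow_le_one₀ (by norm_num) (by norm_num)
  have h13' : (0:ℝ) < (1/3:ℝ)^m := by positivity
  refine ⟨A, ?_, h1, ?_, ?_⟩
  · refine h0.trans ?_
    have : ((X * (1 - X) : ℝ[X])^m).natDegree ≤ m * 2 := by
      apply natDegree_pow_le_of_le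
      compute_degree
    omega
  · intro x hx
    have hb : ∫ y in (0:ℝ)..x, (y*(1-y))^m ≤ ∫ y in (0:ℝ)..x, (1/16:ℝ)^m := by
      apply intervalIntegral.integral_mono_on hx.1 (hint _ _) (by simp)
      intro y hy
      have := hy.2.trans hx.2
      apply pow_le_pow_left₀ (hnn y ⟨hy.1, by linarith⟩)
      nlinarith [hy.1]
    rw [intervalIntegral.integral_const, smul_eq_mul] at hb
    have h16 : (0:ℝ) < (1/16:ℝ)^m := by positivity
    have := key _ (hb.trans (by nlinarith [hx.2]))
    linarith [h2 x ⟨hx.1, by linarith [hx.2]⟩]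
  · intro x hx
    have hb : ∫ y in x..(1:ℝ), (y*(1-y))^m ≤ ∫ y in x..(1:ℝ), (1/16:ℝ)^m := by
      apply intervalIntegral.integral_mono_on hx.2 (hint _ _) (by simp)
      intro y hy
      have := hx.1.trans hy.1
      apply pow_le_pow_left₀ (hnn y ⟨by linarith, hy.2⟩)
      nlinarith [hy.2]
    rw [intervalIntegral.integral_const, smul_eq_mul] at hb
    have h16 : (0:ℝ) < (1/16:ℝ)^m := by positivity
    have := key _ (hb.trans (by nlinarith [hx.1]))
    linarith [h3 x ⟨by linarith [hx.1], hx.2⟩]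

lemma exists_kernel (k : ℕ) : ∃ S : ℝ[X], S.natDegree ≤ 2 * k + 1 ∧
    (∀ y ∈ Set.Icc (-1:ℝ) 1, (y * S.eval y)^2 ≤ 1) ∧
    (∀ y : ℝ, 0 < y → y ≤ 1 / (2 * k + 1) → (2/5) * (2 * k + 1 : ℝ)^2 ≤ (S.eval y)^2) := by
  set T := Polynomial.Chebyshev.T ℝ ((2 * k + 1 : ℕ) : ℤ) with hT
  have hsin : ∀ u : ℝ, (T.eval (Real.sin u))^2 = (Real.sin ((2 * k + 1) * u))^2 := by
    intro u
    rw [← Real.cos_pi_div_two_sub, hT, Polynomial.Chebyshev.T_real_cos]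
    have : (((2 * k + 1 : ℕ) : ℤ) : ℝ) * (Real.pi / 2 - u)
        = (Real.pi / 2 - (2 * k + 1) * u) + k * Real.pi := by push_cast; ring
    rw [this, Real.cos_add_nat_mul_pi, Real.cos_pi_div_two_sub, mul_pow, ← pow_mul, mul_comm k 2,
      pow_mul]
    simp
  have h0 : T.eval 0 = 0 := by
    have := hsin 0
    simpa using this
  obtain ⟨S, hS⟩ : (X : ℝ[X]) ∣ T := by
    rw [X_dvd_iff, coeff_zero_eq_eval_zero]; exact h0
  have hev : ∀ y, y * S.eval y = T.eval y := by intro y; rw [hS]; simp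
  refine ⟨S, ?_, ?_, ?_⟩
  · have hd : T.natDegree = 2 * k + 1 := by
      rw [hT, Polynomial.Chebyshev.natDegree_T]; rfl
    by_cases hz : S = 0
    · simp [hz]
    · rw [hS, natDegree_X_mul hz] at hd
      omega
  · intro y hy
    rw [hev, sq_le_one_iff_abs_le_one]
    exact Polynomial.Chebyshev.abs_eval_T_real_le_one _ (abs_le.2 hy)
  · intro y hy0 hy
    have hn : (1:ℝ) ≤ 2 * k + 1 := by have : (0:ℝ) ≤ k := by positivity
                                      linarith
    set n : ℝ := 2 * k + 1 with hnd
    have hn0 : 0 < n := by linarith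
    have hpi := Real.pi_pos
    have hy1 : y ≤ 1 := hy.trans (by rw [div_le_one hn0]; exact hn)
    have hsu : Real.sin (Real.arcsin y) = y := Real.sin_arcsin (by linarith) hy1
    have hu0 : 0 < Real.arcsin y := Real.arcsin_pos.2 hy0
    have hyu : y ≤ Real.arcsin y := by
      have := Real.sin_le hu0.le
      rwa [hsu] at this
    have hpn : Real.pi / 2 / n ≤ Real.pi / 2 := div_le_self (by positivity) hn
    have hun : Real.arcsin y ≤ Real.pi / 2 / n := by
      rw [Real.arcsin_le_iff_le_sin ⟨by linarith, hy1⟩ ⟨by linarith [show 0 < Real.pi/2/n by positivity], hpn⟩]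
      refine hy.trans ?_
      have := Real.mul_le_sin (x := Real.pi/2/n) (by positivity) hpn
      have he : 2 / Real.pi * (Real.pi / 2 / n) = 1 / n := by field_simp
      rwa [he] at this
    have hs := Real.mul_le_sin (x := n * Real.arcsin y) (by positivity) (by
      rw [le_div_iff₀ hn0] at hun; linarith)
    have h1 : 2 / Real.pi * (n * y) ≤ Real.sin (n * Real.arcsin y) :=
      le_trans (by gcongr) hs
    have h2 : (2 / Real.pi * (n * y))^2 ≤ (y * S.eval y)^2 := by
      rw [hev]
      have := hsin (Real.arcsin y)
      rw [hsu] at this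
      rw [this]
      exact pow_le_pow_left₀ (by positivity) h1 2
    have h3 : (2/5:ℝ) ≤ (2/Real.pi)^2 := by
      rw [div_pow, div_le_div_iff₀ (by norm_num) (by positivity)]
      nlinarith [Real.pi_lt_d2]
    have h4 : (2 / Real.pi)^2 * n^2 ≤ (S.eval y)^2 := by
      have : y^2 * ((2 / Real.pi)^2 * n^2) ≤ y^2 * (S.eval y)^2 := by
        calc _ = (2 / Real.pi * (n * y))^2 := by ring
          _ ≤ _ := h2
          _ = _ := by ring
      exact le_of_mul_le_mul_left this (by positivity)
    refine le_trans ?_ h4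
    gcongr

lemma inv_sq_integral (a b : ℝ) (hab : a ≤ b) (h : 0 < a ∨ b < 0) :
    IntervalIntegrable (fun y : ℝ => (y^2)⁻¹) MeasureTheory.volume a b ∧
    ∫ y in a..b, (y^2)⁻¹ = a⁻¹ - b⁻¹ := by
  have hne : ∀ y ∈ Set.uIcc a b, y ≠ 0 := by
    intro y hy
    rw [Set.uIcc_of_le hab] at hy
    rcases h with h | h
    · exact (h.trans_le hy.1).ne'
    · exact (hy.2.trans_lt h).ne
  have hi : IntervalIntegrable (fun y : ℝ => (y^2)⁻¹) MeasureTheory.volume a b := by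
    apply ContinuousOn.intervalIntegrable
    apply ContinuousOn.inv₀ (by fun_prop)
    intro y hy
    exact pow_ne_zero 2 (hne y hy)
  refine ⟨hi, ?_⟩
  have := intervalIntegral.integral_eq_sub_of_hasDerivAt (f := fun y : ℝ => -y⁻¹) (a := a) (b := b)
    (f' := fun y => (y^2)⁻¹) (fun y hy => by
      have := (hasDerivAt_inv (hne y hy)).neg
      rw [neg_neg] at this
      exact this) hi
  rw [this]; ring

lemma exists_coarse (δ : ℝ) (h0 : 0 < δ) (h1 : δ ≤ 1) : ∃ Q : ℝ[X],
    (Q.natDegree : ℝ) ≤ 400 / δ ∧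
    (∀ y ∈ Set.Icc (-1:ℝ) 1, 0 ≤ Q.eval y ∧ Q.eval y ≤ 1) ∧
    (∀ y ∈ Set.Icc (-1:ℝ) (-(δ/2)), Q.eval y ≤ 1/16) ∧
    (∀ y ∈ Set.Icc (δ/2) 1, 15/16 ≤ Q.eval y) := by
  set k := ⌈80 / δ⌉₊ with hk
  have hk1 : 80 / δ ≤ k := Nat.le_ceil _
  have hk2 : (k:ℝ) < 80 / δ + 1 := Nat.ceil_lt_add_one (by positivity)
  have hd1 : 1 ≤ 1 / δ := by rw [le_div_iff₀ h0]; linarith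
  obtain ⟨S, hS, hSb, hSl⟩ := exists_kernel k
  have hn : (1:ℝ) ≤ 2 * k + 1 := by have : (0:ℝ) ≤ k := by positivity
                                    linarith
  have hnδ : 160 / δ ≤ (2 * k + 1 : ℝ) := by
    have : 160 / δ = 2 * (80 / δ) := by ring
    linarith
  set n : ℝ := 2 * k + 1 with hnd
  have hn0 : 0 < n := by linarith
  have hev : ∀ y, (S^2).eval y = (S.eval y)^2 := by intro y; simp
  have hint : ∀ u v, IntervalIntegrable (fun x : ℝ => (S.eval x)^2) MeasureTheory.volume u v :=
    fun u v => (by fun_prop : Continuous (fun x : ℝ => (S.eval x)^2)).intervalIntegrable _ _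
  have hnn : ∀ a b : ℝ, a ≤ b → 0 ≤ ∫ y in a..b, (S.eval y)^2 := fun a b h =>
    intervalIntegral.integral_nonneg h (fun x _ => sq_nonneg _)
  have hi1 : 1 / n ≤ 1 := by rw [div_le_one hn0]; exact hn
  have hi0 : 0 < 1 / n := by positivity
  obtain ⟨Q, hQd, hQb, hQ1, hQ2⟩ := exists_step (S^2) (-1) 1 (n/5)
    (by intro x _; rw [hev]; positivity) (by positivity) (by
      simp only [hev]
      have e1 := intervalIntegral.integral_add_adjacent_intervals (hint (-1) (1/n/2)) (hint (1/n/2) (1/n))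
      have e2 := intervalIntegral.integral_add_adjacent_intervals (hint (-1) (1/n)) (hint (1/n) 1)
      have p1 := hnn (-1) (1/n/2) (by linarith)
      have p2 := hnn (1/n) 1 hi1
      have p3 : ∫ x in (1/n/2)..(1/n), (2/5 * n^2) ≤ ∫ x in (1/n/2)..(1/n), (S.eval x)^2 := by
        apply intervalIntegral.integral_mono_on (by linarith) (by simp) (hint _ _)
        intro x hx
        exact hSl x (by linarith [hx.1]) hx.2
      rw [intervalIntegral.integral_const, smul_eq_mul] at p3
      have : (1/n - 1/n/2) * (2/5 * n^2) = n / 5 := by field_simp; ring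
      linarith)
  simp only [hev] at hQ1 hQ2
  have hpt : ∀ y ∈ Set.Icc (-1:ℝ) 1, y ≠ 0 → (S.eval y)^2 ≤ (y^2)⁻¹ := by
    intro y hy hy0
    have := hSb y hy
    have h2 : 0 < y^2 := by positivity
    rw [← one_div, le_div_iff₀ h2]
    nlinarith
  have key : ∀ I : ℝ, I ≤ 2 / δ → I / (n/5) ≤ 1/16 := by
    intro I hI
    rw [div_le_iff₀ (by positivity)]
    have : 160 / δ = 80 * (2 / δ) := by ring
    linarith
  have hδi : (δ/2)⁻¹ = 2 / δ := by rw [inv_div]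
  refine ⟨Q, ?_, hQb, ?_, ?_⟩
  · have : Q.natDegree ≤ 2 * (2 * k + 1) + 1 := by
      refine hQd.trans ?_
      have := natDegree_pow_le_of_le 2 hS
      omega
    have h2 : (Q.natDegree : ℝ) ≤ 2 * (2 * k + 1) + 1 := by exact_mod_cast this
    have e1 : 80 / δ = 80 * (1/δ) := by ring
    have e2 : 400 / δ = 400 * (1/δ) := by ring
    linarith
  · intro y hy
    have hy0 : y < 0 := by linarith [hy.2]
    obtain ⟨i1, i2⟩ := inv_sq_integral (-1) y hy.1 (Or.inr hy0)
    have hb : ∫ x in (-1:ℝ)..y, (S.eval x)^2 ≤ ∫ x in (-1:ℝ)..y, (x^2)⁻¹ := by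
      apply intervalIntegral.integral_mono_on hy.1 (hint _ _) i1
      intro x hx
      exact hpt x ⟨hx.1, by linarith [hx.2]⟩ (by linarith [hx.2] : x < 0).ne
    have hc : -y⁻¹ ≤ 2 / δ := by
      rw [← hδi, ← inv_neg]
      exact inv_anti₀ (by positivity) (by linarith [hy.2])
    refine (hQ1 y ⟨hy.1, by linarith⟩).trans (key _ ?_)
    rw [i2] at hb
    norm_num at hb
    linarith
  · intro y hy
    have hy0 : 0 < y := by linarith [hy.1]
    obtain ⟨i1, i2⟩ := inv_sq_integral y 1 hy.2 (Or.inl hy0)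
    have hb : ∫ x in y..(1:ℝ), (S.eval x)^2 ≤ ∫ x in y..(1:ℝ), (x^2)⁻¹ := by
      apply intervalIntegral.integral_mono_on hy.2 (hint _ _) i1
      intro x hx
      exact hpt x ⟨by linarith [hx.1], hx.2⟩ (by linarith [hx.1] : 0 < x).ne'
    have hc : y⁻¹ ≤ 2 / δ := by
      rw [← hδi]
      exact inv_anti₀ (by positivity) hy.1
    have := hQ2 y ⟨by linarith, hy.2⟩
    have h3 := key (∫ x in y..(1:ℝ), (S.eval x)^2) (by
      rw [i2] at hb
      norm_num at hb
      linarith)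
    linarith

theorem sign_filter_polynomial_exists :
    ∃ C : ℝ, 0 < C ∧
      ∀ Δ t α : ℝ, 0 < Δ → Δ ≤ 1 → 0 < t → t < 1 → 0 < α → α < 1 →
        ∃ p : Polynomial ℝ,
          (p.natDegree : ℝ) ≤ C * (1 / (Δ * t)) * Real.log (1 / α) ∧
          (∀ x ∈ Set.Icc (-1 : ℝ) 1, |p.eval x| ≤ 1) ∧
          (∀ x ∈ Set.Icc (0 : ℝ) (1 - Δ * (1 + t)), |p.eval x| ≤ α) ∧
          (∀ x ∈ Set.Icc (1 - Δ * (1 - t)) 1, 1 / 4 ≤ p.eval x) := by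
  refine ⟨2000, by norm_num, ?_⟩
  intro Δ t α hΔ hΔ1 ht ht1 hα hα1
  have hL0 : 0 ≤ Real.log (1 / α) := Real.log_nonneg (by rw [le_div_iff₀ hα]; linarith)
  have hδ : 0 < Δ * t := by positivity
  by_cases hα4 : 1 / 4 ≤ α
  · refine ⟨Polynomial.C (1/4), ?_, ?_, ?_, ?_⟩
    · rw [natDegree_C]; push_cast; positivity
    · intro x _; rw [eval_C, abs_of_pos] <;> norm_num
    · intro x _; rw [eval_C, abs_of_pos (by norm_num)]; exact hα4
    · intro x _; rw [eval_C]
  push Not at hα4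
  have hδ1 : Δ * t ≤ 1 := by nlinarith
  have hL : 1 ≤ Real.log (1 / α) := by
    rw [Real.le_log_iff_exp_le (by positivity), le_div_iff₀ hα]
    nlinarith [Real.exp_one_lt_d9, Real.exp_pos 1]
  obtain ⟨Q, hQd, hQb, hQ1, hQ2⟩ := exists_coarse (Δ * t) hδ hδ1
  set L := Real.log (1 / α) with hLd
  set m := ⌈L⌉₊ with hm
  have hm1 : L ≤ m := Nat.le_ceil _
  have hm2 : (m:ℝ) < L + 1 := Nat.ceil_lt_add_one hL0
  obtain ⟨A, hAd, hAb, hA1, hA2⟩ := exists_amp m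
  have hαm : (1/3:ℝ)^m ≤ α := by
    have h3 : Real.exp m ≤ 3^m := by
      rw [← mul_one (m:ℝ), Real.exp_nat_mul]
      exact pow_le_pow_left₀ (Real.exp_pos 1).le (by linarith [Real.exp_one_lt_d9]) m
    have h4 : 1 / α ≤ Real.exp m := by
      rw [← Real.log_le_iff_le_exp (by positivity)]; exact hm1
    have h5 : 1 / α ≤ 3^m := h4.trans h3
    rw [one_div_pow, div_le_iff₀ (by positivity)]
    rw [div_le_iff₀ hα] at h5
    linarith
  set R : ℝ[X] := Polynomial.C (1/2) * (X - Polynomial.C (1 - Δ)) with hR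
  have hRev : ∀ x, R.eval x = (x - (1 - Δ)) / 2 := by intro x; simp [hR]; ring
  have hRd : R.natDegree ≤ 1 := by rw [hR]; compute_degree
  have hpe : ∀ x, (A.comp (Q.comp R)).eval x = A.eval (Q.eval ((x - (1 - Δ)) / 2)) := by
    intro x; rw [eval_comp, eval_comp, hRev]
  have hin : ∀ x ∈ Set.Icc (-1:ℝ) 1, (x - (1 - Δ)) / 2 ∈ Set.Icc (-1:ℝ) 1 := by
    intro x hx
    constructor <;> linarith [hx.1, hx.2]
  have hr : ∀ x ∈ Set.Icc (-1:ℝ) 1, Q.eval ((x - (1 - Δ)) / 2) ∈ Set.Icc (0:ℝ) 1 :=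
    fun x hx => hQb _ (hin x hx)
  refine ⟨A.comp (Q.comp R), ?_, ?_, ?_, ?_⟩
  · have h1 : (A.comp (Q.comp R)).natDegree ≤ (2 * m + 1) * Q.natDegree := by
      refine natDegree_comp_le.trans (Nat.mul_le_mul hAd (natDegree_comp_le.trans ?_))
      calc _ ≤ Q.natDegree * 1 := Nat.mul_le_mul le_rfl hRd
        _ = _ := mul_one _
    have h2 : ((A.comp (Q.comp R)).natDegree : ℝ) ≤ (2 * m + 1) * Q.natDegree := by
      exact_mod_cast h1
    calc _ ≤ _ := h2
      _ ≤ (5 * L) * (400 / (Δ * t)) := by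
        apply mul_le_mul _ hQd (by positivity) (by positivity)
        linarith
      _ = _ := by ring
  · intro x hx
    rw [hpe, abs_le]
    have := hAb _ (hr x hx)
    constructor <;> linarith [this.1, this.2]
  · intro x hx
    have hx' : x ∈ Set.Icc (-1:ℝ) 1 := ⟨by linarith [hx.1], by nlinarith [hx.2]⟩
    rw [hpe, abs_of_nonneg (hAb _ (hr x hx')).1]
    refine (hA1 _ ⟨(hr x hx').1, hQ1 _ ⟨(hin x hx').1, ?_⟩⟩).trans hαm
    linarith [hx.2]
  · intro x hx
    have hx' : x ∈ Set.Icc (-1:ℝ) 1 := ⟨by nlinarith [hx.1], hx.2⟩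
    rw [hpe]
    refine hA2 _ ⟨hQ2 _ ⟨?_, (hin x hx').2⟩, (hr x hx').2⟩
    linarith [hx.1]
end

section
/- There exists a constant C > 0 such that for every Δ ∈ (0, 1/2) and every α ∈ (0,1), there exists a real polynomial p with degree at most C · Δ^{−1/2} · log(1/α) satisfying: |p(x)| ≤ α for all x ∈ [0, 1 − 2Δ]; |p(x)| ≤ 1 for all x ∈ [−1, 1]; and 1/4 < p(1) ≤ 1. -/
open Polynomial in
theorem cheb_mono_aux (n : ℕ) {y z : ℝ} (hy : 1 ≤ y) (hyz : y ≤ z) :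
    (Chebyshev.T ℝ (n : ℤ)).eval y ≤ (Chebyshev.T ℝ (n : ℤ)).eval z := by
  have hz : 1 ≤ z := hy.trans hyz
  rw [← Real.cosh_arcosh hy, ← Real.cosh_arcosh hz, Chebyshev.T_real_cosh,
    Chebyshev.T_real_cosh, Real.cosh_le_cosh]
  have h1 := Real.arcosh_nonneg hy
  have h2 := (Real.arcosh_le_arcosh (by linarith) (by linarith)).2 hyz
  have hn : (0 : ℝ) ≤ ((n : ℤ) : ℝ) := by positivity
  rw [abs_of_nonneg (mul_nonneg hn h1), abs_of_nonneg (mul_nonneg hn (h1.trans h2))]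
  exact mul_le_mul_of_nonneg_left h2 hn

open Polynomial in
theorem cheb_large_aux (n : ℕ) {s : ℝ} (hs : 0 < s) (hs1 : s < 1) :
    Real.exp (n * s) / 2 ≤ (Chebyshev.T ℝ (n : ℤ)).eval ((1 + s ^ 2) / (1 - s ^ 2)) := by
  have h1 : 0 < 1 - s := by linarith
  have h2 : 0 < 1 + s := by linarith
  have hq : 0 < (1 + s) / (1 - s) := by positivity
  set t := Real.log ((1 + s) / (1 - s)) with ht
  have hst : s ≤ t := by
    rw [ht, Real.le_log_iff_exp_le hq, le_div_iff₀ h1]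
    have h3 := Real.add_one_le_exp (-s)
    have h4 : Real.exp s * Real.exp (-s) = 1 := by rw [← Real.exp_add]; simp
    nlinarith [Real.exp_pos s]
  have hc : (1 + s ^ 2) / (1 - s ^ 2) = Real.cosh t := by
    rw [Real.cosh_eq, Real.exp_neg, ht, Real.exp_log hq]
    have h5 : 1 - s ^ 2 = (1 - s) * (1 + s) := by ring
    rw [h5]
    field_simp
    ring
  rw [hc, Chebyshev.T_real_cosh, Real.cosh_eq]
  have h6 : Real.exp (n * s) ≤ Real.exp (((n : ℤ) : ℝ) * t) := by
    apply Real.exp_le_exp.2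
    push_cast
    exact mul_le_mul_of_nonneg_left hst (by positivity)
  have h7 := Real.exp_pos (-(((n : ℤ) : ℝ) * t))
  linarith

theorem monomial_filter_polynomial_exists :
    ∃ C : ℝ, 0 < C ∧
      ∀ Δ α : ℝ, 0 < Δ → Δ < 1 / 2 → 0 < α → α < 1 →
        ∃ p : Polynomial ℝ,
          (p.natDegree : ℝ) ≤ C * (1 / Real.sqrt Δ) * Real.log (1 / α) ∧
          (∀ x ∈ Set.Icc (0 : ℝ) (1 - 2 * Δ), |p.eval x| ≤ α) ∧
          (∀ x ∈ Set.Icc (-1 : ℝ) 1, |p.eval x| ≤ 1) ∧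
          (1 / 4 < p.eval 1 ∧ p.eval 1 ≤ 1) := by
  refine ⟨3, by norm_num, ?_⟩
  intro Δ α hΔ hΔ2 hα hα1
  have hL0 : 0 ≤ Real.log (1 / α) := by
    apply Real.log_nonneg
    rw [le_div_iff₀ hα]; linarith
  by_cases h4 : 1 / 4 < α
  · refine ⟨Polynomial.C α, ?_, ?_, ?_, ?_⟩
    · simp only [Polynomial.natDegree_C, Nat.cast_zero]
      positivity
    · intro x _; simp [abs_of_pos hα]
    · intro x _; simp [abs_of_pos hα]; exact hα1.le
    · simp only [Polynomial.eval_C]; exact ⟨h4, hα1.le⟩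
  push Not at h4
  set L := Real.log (1 / α) with hL
  have hexpL : Real.exp L = 1 / α := Real.exp_log (by positivity)
  have h4α : 4 ≤ 1 / α := by rw [le_div_iff₀ hα]; linarith
  have hL1 : 1 ≤ L := by
    rw [hL, Real.le_log_iff_exp_le (by positivity)]
    have := Real.exp_one_lt_d9
    linarith
  set s := Real.sqrt Δ with hs
  have hs0 : 0 < s := Real.sqrt_pos.2 hΔ
  have hss : s ^ 2 = Δ := Real.sq_sqrt hΔ.le
  have hs1 : s < 1 := by nlinarith
  set n := ⌈2 * L / s⌉₊ with hn
  have hn1 : 2 * L / s ≤ n := Nat.le_ceil _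
  have hn2 : (n : ℝ) < 2 * L / s + 1 := Nat.ceil_lt_add_one (by positivity)
  have hd : 0 < 1 - Δ := by linarith
  set z := (1 + Δ) / (1 - Δ) with hz
  set M := (Polynomial.Chebyshev.T ℝ (n : ℤ)).eval z with hM
  have hMα : 1 / α ≤ M := by
    have h := cheb_large_aux n hs0 hs1
    rw [hss] at h
    have h5 : L + L ≤ n * s := by
      rw [div_le_iff₀ hs0] at hn1; linarith
    have h6 := Real.exp_le_exp.2 h5
    rw [Real.exp_add, hexpL] at h6
    have h7 : Real.exp (n * s) / 2 ≤ M := h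
    nlinarith
  have hM0 : 0 < M := by linarith
  have hMα2 : 1 / M ≤ α := by
    rw [div_le_iff₀ hM0]
    rw [div_le_iff₀ hα] at hMα
    linarith
  set q : Polynomial ℝ := Polynomial.C (1 / (1 - Δ)) * Polynomial.X
    + Polynomial.C (Δ / (1 - Δ)) with hq
  have hev : ∀ x, (Polynomial.C (1 / M) * (Polynomial.Chebyshev.T ℝ (n : ℤ)).comp q).eval x
      = 1 / M * (Polynomial.Chebyshev.T ℝ (n : ℤ)).eval ((x + Δ) / (1 - Δ)) := by
    intro x
    simp only [hq, Polynomial.eval_mul, Polynomial.eval_comp, Polynomial.eval_add,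
      Polynomial.eval_C, Polynomial.eval_X]
    congr 2
    ring
  have hsmall : ∀ x, -1 ≤ x → x ≤ 1 - 2 * Δ →
      |1 / M * (Polynomial.Chebyshev.T ℝ (n : ℤ)).eval ((x + Δ) / (1 - Δ))| ≤ α := by
    intro x hx1 hx2
    have hy : |(x + Δ) / (1 - Δ)| ≤ 1 := by
      rw [abs_le, le_div_iff₀ hd, div_le_iff₀ hd]
      constructor <;> linarith
    have := Polynomial.Chebyshev.abs_eval_T_real_le_one (n : ℤ) hy
    rw [abs_mul, abs_of_pos (show 0 < 1 / M by positivity)]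
    calc _ ≤ 1 / M * 1 := mul_le_mul_of_nonneg_left this (by positivity)
      _ ≤ α := by linarith
  refine ⟨Polynomial.C (1 / M) * (Polynomial.Chebyshev.T ℝ (n : ℤ)).comp q, ?_, ?_, ?_, ?_⟩
  · have hdeg : (Polynomial.C (1 / M) *
        (Polynomial.Chebyshev.T ℝ (n : ℤ)).comp q).natDegree ≤ n := by
      refine (Polynomial.natDegree_C_mul_le _ _).trans ?_
      refine Polynomial.natDegree_comp_le.trans ?_
      rw [Polynomial.Chebyshev.natDegree_T]
      have : q.natDegree ≤ 1 := Polynomial.natDegree_linear_le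
      simpa using Nat.mul_le_mul_left n this
    have h1 : (1 : ℝ) ≤ L / s := by rw [le_div_iff₀ hs0]; linarith
    calc _ ≤ (n : ℝ) := by exact_mod_cast hdeg
      _ ≤ 2 * L / s + L / s := by linarith
      _ = 3 * (1 / s) * L := by ring
  · intro x hx
    rw [hev]
    exact hsmall x (by linarith [hx.1]) hx.2
  · intro x hx
    rw [hev]
    by_cases hx2 : x ≤ 1 - 2 * Δ
    · exact (hsmall x hx.1 hx2).trans hα1.le
    push Not at hx2
    have hy : 1 ≤ (x + Δ) / (1 - Δ) := by rw [le_div_iff₀ hd]; linarith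
    have hyz : (x + Δ) / (1 - Δ) ≤ z := by
      rw [hz]
      exact div_le_div_of_nonneg_right (by linarith [hx.2]) hd.le
    have h1 := Polynomial.Chebyshev.one_le_eval_T_real (n : ℤ) hy
    have h2 := cheb_mono_aux n hy hyz
    rw [abs_of_nonneg (mul_nonneg (by positivity) (by linarith)), one_div, inv_mul_le_iff₀ hM0]
    linarith
  · have h1 : 1 / M * (Polynomial.Chebyshev.T ℝ (n : ℤ)).eval ((1 + Δ) / (1 - Δ)) = 1 :=
      one_div_mul_cancel hM0.ne'
    rw [hev, h1]
    norm_num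
end

section
/- For every fixed α ∈ (0, 1/4) there exist t* ∈ (0,1), Δ* ∈ (0,1) and constants 0 < C₁ ≤ C₂ such that for every t ∈ [t*, 1) and every Δ ∈ (0, Δ*) there exists a natural number d with C₁/√Δ ≤ d ≤ C₂/√Δ (so d ∈ Θ(1/√Δ)) for which the degree-d polynomial f(x) = T_d((2x − (x₀ − 1))/(x₀ + 1)) / (2 T_d((2 − (x₀ − 1))/(x₀ + 1))), where x₀ = 1 − (1+t)Δ, satisfies: |f(x)| ≤ 1 for all x ∈ [−1,1]; |f(x)| ≤ α for all x ∈ [0, 1 − (1+t)Δ]; and f(x) ≥ 1/4 for all x ∈ [1 − (1−t)Δ, 1]. -/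
open Polynomial.Chebyshev in
lemma aux_T {z : ℝ} (d : ℕ) (hz : 1 ≤ z) :
    ∃ θ : ℝ, 0 ≤ θ ∧ Real.cosh θ = z ∧ (T ℝ d).eval z = Real.cosh (d * θ) := by
  refine ⟨Real.arcosh z, Real.arcosh_nonneg hz, Real.cosh_arcosh hz, ?_⟩
  have := T_real_cosh (Real.arcosh z) (d : ℤ)
  rw [Real.cosh_arcosh hz] at this
  simpa using this

lemma aux_sinh (d : ℕ) {u : ℝ} (hu : 0 ≤ u) : d * Real.sinh u ≤ Real.sinh (d * u) := by
  induction d with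
  | zero => simp
  | succ n ih =>
    push_cast
    rw [show ((n : ℝ) + 1) * u = n * u + u by ring, Real.sinh_add]
    have h1 := Real.one_le_cosh u
    have h2 := Real.one_le_cosh (n * u)
    have h3 : 0 ≤ Real.sinh u := Real.sinh_nonneg_iff.2 hu
    have h4 : 0 ≤ Real.sinh (n * u) := Real.sinh_nonneg_iff.2 (by positivity)
    nlinarith [mul_nonneg h4 (sub_nonneg.2 h1), mul_nonneg h3 (sub_nonneg.2 h2)]

open Polynomial.Chebyshev in
lemma aux_low {z : ℝ} (d : ℕ) (hz : 1 ≤ z) : 1 + d ^ 2 * (z - 1) ≤ (T ℝ d).eval z := by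
  obtain ⟨θ, h0, hc, hT⟩ := aux_T d hz
  rw [hT, ← hc]
  have key : ∀ v : ℝ, Real.cosh v = 1 + 2 * Real.sinh (v / 2) ^ 2 := by
    intro v
    have h1 := Real.cosh_two_mul (v / 2)
    have h2 := Real.cosh_sq (v / 2)
    rw [show 2 * (v / 2) = v by ring] at h1
    linarith
  rw [key θ, key (d * θ)]
  have h1 := aux_sinh d (u := θ / 2) (by positivity)
  have h3 : 0 ≤ Real.sinh (θ / 2) := Real.sinh_nonneg_iff.2 (by positivity)
  have h4 : (d * Real.sinh (θ / 2)) ^ 2 ≤ Real.sinh (d * (θ / 2)) ^ 2 :=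
    pow_le_pow_left₀ (by positivity) h1 2
  rw [show d * θ / 2 = d * (θ / 2) by ring]
  nlinarith

open Polynomial.Chebyshev in
lemma aux_mono {z w : ℝ} (d : ℕ) (hz : 1 ≤ z) (hw : z ≤ w) :
    (T ℝ d).eval z ≤ (T ℝ d).eval w := by
  obtain ⟨θ, h0, hc, hT⟩ := aux_T d hz
  obtain ⟨φ, h0', hc', hT'⟩ := aux_T d (hz.trans hw)
  rw [hT, hT']
  have h : θ ≤ φ := by
    rw [← hc, ← hc', Real.cosh_le_cosh, abs_of_nonneg h0, abs_of_nonneg h0'] at hw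
    exact hw
  rw [Real.cosh_le_cosh, abs_of_nonneg (by positivity), abs_of_nonneg (by positivity)]
  gcongr

open Polynomial.Chebyshev in
lemma aux_up {z w : ℝ} (d : ℕ) (hz : 1 ≤ z) (hw : z ≤ w) (hd : d ^ 2 * (w - z) ≤ 1 / 8) :
    (T ℝ d).eval w ≤ 2 * (T ℝ d).eval z := by
  obtain ⟨θ, h0, hc, hT⟩ := aux_T d hz
  obtain ⟨φ, h0', hc', hT'⟩ := aux_T d (hz.trans hw)
  rw [hT, hT']
  have h : θ ≤ φ := by
    rw [← hc, ← hc', Real.cosh_le_cosh, abs_of_nonneg h0, abs_of_nonneg h0'] at hw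
    exact hw
  obtain ⟨δ, rfl⟩ : ∃ δ, φ = θ + δ := ⟨φ - θ, by ring⟩
  have hδ : 0 ≤ δ := by linarith
  have h1 : 1 + δ ^ 2 / 2 ≤ Real.cosh δ := by
    have h1 := Real.cosh_two_mul (δ / 2)
    have h2 := Real.cosh_sq (δ / 2)
    have h3 : δ / 2 ≤ Real.sinh (δ / 2) := Real.self_le_sinh_iff.2 (by positivity)
    rw [show 2 * (δ / 2) = δ by ring] at h1
    nlinarith
  have h2 : δ ^ 2 / 2 ≤ w - z := by
    have e := Real.cosh_add θ δ
    have a := Real.sinh_nonneg_iff.2 h0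
    have b := Real.sinh_nonneg_iff.2 hδ
    have c := Real.one_le_cosh θ
    rw [← hc, ← hc', e]
    nlinarith [mul_nonneg a b, sq_nonneg δ, mul_nonneg (sub_nonneg.2 c) (sq_nonneg δ)]
  have h3 : d * δ ≤ 1 / 2 := by
    have : (d * δ) ^ 2 ≤ (1 / 2) ^ 2 := by
      have := mul_le_mul_of_nonneg_left h2 (sq_nonneg (d : ℝ))
      nlinarith
    exact le_of_sq_le_sq this (by norm_num)
  have h4 : Real.exp (d * δ) ≤ 2 := by
    have a : Real.exp (d * δ) ≤ Real.exp (1 / 2) := Real.exp_le_exp.2 h3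
    have b : Real.exp (1 / 2) ^ 2 = Real.exp 1 := by
      rw [← Real.exp_nat_mul]; norm_num
    have c := Real.exp_one_lt_d9
    have : Real.exp (1 / 2) ≤ 2 := by
      apply le_of_sq_le_sq _ (by norm_num)
      rw [b]; linarith
    linarith
  rw [show (d : ℝ) * (θ + δ) = d * θ + d * δ by ring]
  have h5 : Real.exp (d * θ + d * δ) = Real.exp (d * θ) * Real.exp (d * δ) := Real.exp_add _ _
  have h6 : Real.exp (-(d * θ + d * δ)) ≤ Real.exp (-(d * θ)) := by
    apply Real.exp_le_exp.2
    have : 0 ≤ d * δ := by positivity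
    linarith
  have p1 := Real.exp_pos (d * θ)
  have p2 := Real.exp_pos (-(d * θ))
  rw [Real.cosh_eq, Real.cosh_eq, h5]
  nlinarith

theorem dolph_chebyshev_filter
    (α : ℝ) (hα0 : 0 < α) (hα : α < 1 / 4) :
    ∃ tstar Δstar C₁ C₂ : ℝ,
      0 < tstar ∧ tstar < 1 ∧ 0 < Δstar ∧ Δstar < 1 ∧ 0 < C₁ ∧ C₁ ≤ C₂ ∧
      ∀ t Δ : ℝ, tstar ≤ t → t < 1 → 0 < Δ → Δ < Δstar →
        ∃ d : ℕ,
          C₁ / Real.sqrt Δ ≤ (d : ℝ) ∧ (d : ℝ) ≤ C₂ / Real.sqrt Δ ∧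
          (let x₀ : ℝ := 1 - (1 + t) * Δ
           let f : ℝ → ℝ := fun x =>
             (Polynomial.Chebyshev.T ℝ d).eval ((2 * x - (x₀ - 1)) / (x₀ + 1)) /
               (2 * (Polynomial.Chebyshev.T ℝ d).eval ((2 - (x₀ - 1)) / (x₀ + 1)))
           (∀ x ∈ Set.Icc (-1 : ℝ) 1, |f x| ≤ 1) ∧
           (∀ x ∈ Set.Icc (0 : ℝ) (1 - (1 + t) * Δ), |f x| ≤ α) ∧
           (∀ x ∈ Set.Icc (1 - (1 - t) * Δ) 1, 1 / 4 ≤ f x)) := by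
  obtain ⟨L, hL⟩ : ∃ L : ℝ, L = 1 / α := ⟨_, rfl⟩
  have hLα : L * α = 1 := by rw [hL]; field_simp
  have hL4 : 4 < L := by nlinarith
  have hε : 1 / (16 * (L + 1) ^ 2) < 1 := by
    rw [div_lt_one (by positivity)]; nlinarith
  refine ⟨1 - 1 / (16 * (L + 1) ^ 2), 1 / 4, L, L + 1, by linarith, ?_, by norm_num, by norm_num,
    by linarith, by linarith, ?_⟩
  · have : 0 < 1 / (16 * (L + 1) ^ 2) := by positivity
    linarith
  intro t Δ ht ht1 hΔ hΔ4
  have ht0 : 0 < t := by linarith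
  have hs : 0 < Real.sqrt Δ := Real.sqrt_pos.2 hΔ
  have hss : Real.sqrt Δ ^ 2 = Δ := Real.sq_sqrt hΔ.le
  have hs1 : Real.sqrt Δ ≤ 1 := by nlinarith
  have hd1 := Nat.le_ceil (L / Real.sqrt Δ)
  have hd2 : (⌈L / Real.sqrt Δ⌉₊ : ℝ) ≤ (L + 1) / Real.sqrt Δ := by
    have a := Nat.ceil_lt_add_one (a := L / Real.sqrt Δ) (by positivity)
    have b : 1 ≤ 1 / Real.sqrt Δ := by rw [le_div_iff₀ hs]; linarith
    rw [add_div]; linarith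
  generalize ⌈L / Real.sqrt Δ⌉₊ = d at hd1 hd2
  refine ⟨d, hd1, hd2, ?_⟩
  intro x₀ f
  have hx0 : x₀ = 1 - (1 + t) * Δ := rfl
  have hx1 : x₀ < 1 := by nlinarith
  have hxh : 1 / 2 < x₀ := by nlinarith
  clear_value x₀
  have hp : 0 < x₀ + 1 := by linarith
  obtain ⟨w, hw⟩ : ∃ w, w = (2 - (x₀ - 1)) / (x₀ + 1) := ⟨_, rfl⟩
  have hw1 : 1 + Δ ≤ w := by
    rw [hw, le_div_iff₀ hp]; nlinarith
  have hdl : L ^ 2 ≤ d ^ 2 * Δ := by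
    rw [div_le_iff₀ hs] at hd1
    rw [← hss, ← mul_pow]
    exact pow_le_pow_left₀ (by linarith) hd1 2
  have hdu : d ^ 2 * Δ ≤ (L + 1) ^ 2 := by
    rw [le_div_iff₀ hs] at hd2
    rw [← hss, ← mul_pow]
    exact pow_le_pow_left₀ (by positivity) hd2 2
  obtain ⟨W, hW⟩ : ∃ W, W = (Polynomial.Chebyshev.T ℝ d).eval w := ⟨_, rfl⟩
  have hWL : L ^ 2 ≤ W := by
    have a := aux_low d (z := w) (by linarith)
    have b : (d : ℝ) ^ 2 * Δ ≤ d ^ 2 * (w - 1) := by gcongr; linarith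
    rw [hW]; linarith
  have hWp : L ≤ W := by nlinarith
  have hW0 : 0 < W := by linarith
  have hf : ∀ x, f x =
      (Polynomial.Chebyshev.T ℝ d).eval ((2 * x - (x₀ - 1)) / (x₀ + 1)) / (2 * W) := by
    intro x; rw [hW, hw]
  clear_value f
  have hsmall : ∀ x, -1 ≤ x → x ≤ x₀ →
      |(Polynomial.Chebyshev.T ℝ d).eval ((2 * x - (x₀ - 1)) / (x₀ + 1))| ≤ 1 := by
    intro x h1 h2
    apply Polynomial.Chebyshev.abs_eval_T_real_le_one
    rw [abs_le, le_div_iff₀ hp, div_le_iff₀ hp]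
    constructor <;> linarith
  have hbig : ∀ x, x₀ ≤ x → x ≤ 1 → 1 ≤ (2 * x - (x₀ - 1)) / (x₀ + 1) ∧
      (2 * x - (x₀ - 1)) / (x₀ + 1) ≤ w := by
    intro x h1 h2
    rw [hw, le_div_iff₀ hp]
    refine ⟨by linarith, ?_⟩
    gcongr; linarith
  refine ⟨?_, ?_, ?_⟩
  · rintro x ⟨h1, h2⟩
    rw [hf, abs_div, abs_of_pos (by positivity : 0 < 2 * W), div_le_one (by positivity)]
    rcases le_total x x₀ with h | h
    · have := hsmall x h1 h
      linarith
    · obtain ⟨a, b⟩ := hbig x h h2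
      have c := aux_mono d a b
      have e := Polynomial.Chebyshev.one_le_eval_T_real d a
      rw [abs_of_nonneg (by linarith)]
      linarith
  · rintro x ⟨h1, h2⟩
    rw [hf, abs_div, abs_of_pos (by positivity : 0 < 2 * W), div_le_iff₀ (by positivity)]
    have := hsmall x (by linarith) (by linarith)
    nlinarith
  · rintro x ⟨h1, h2⟩
    obtain ⟨a, b⟩ := hbig x (by nlinarith) h2
    rw [hf, le_div_iff₀ (by positivity)]
    have c := aux_up d a b ?_
    · rw [← hW] at c; linarith
    have e : w - (2 * x - (x₀ - 1)) / (x₀ + 1) ≤ 2 * (1 - t) * Δ := by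
      rw [hw, ← sub_div, div_le_iff₀ hp]
      have : 0 ≤ (1 - t) * Δ := mul_nonneg (by linarith) hΔ.le
      nlinarith
    have g : (1 - t) * (16 * (L + 1) ^ 2) ≤ 1 := by
      rw [← le_div_iff₀ (by positivity)]; linarith
    calc (d : ℝ) ^ 2 * (w - (2 * x - (x₀ - 1)) / (x₀ + 1))
        ≤ d ^ 2 * (2 * (1 - t) * Δ) := by gcongr
      _ = 2 * (1 - t) * (d ^ 2 * Δ) := by ring
      _ ≤ 2 * (1 - t) * (L + 1) ^ 2 := by
        apply mul_le_mul_of_nonneg_left hdu; linarith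
      _ ≤ 1 / 8 := by linarith
end

section
/- Let p be a real polynomial of degree d, let 0 ≤ a < b ≤ 1, and suppose that p(x) ∈ [0,1] for all x ∈ [0,1], that p(a) ≤ 1/3 and that p(b) ≥ 2/3. Then d² ≥ 1/(3(b − a)). In particular, if a = Δ(1−t) and b = Δ(1+t) for Δ, t ∈ (0,1) then d ≥ √(1/(6Δt)), so any such polynomial distinguishing singular gaps at relative error t must have degree Ω(1/√Δ). -/
open Polynomial

noncomputable def rzTh (n k : ℕ) : ℝ := (2 * k + 1) * Real.pi / (2 * n)
noncomputable def rzW (n k : ℕ) : ℝ := (-1) ^ k / (2 * n * (1 - Real.cos (rzTh n k)))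

lemma rz_pos {n k : ℕ} (hk : k < 2 * n) : 0 < 1 - Real.cos (rzTh n k) := by
  have hn : 0 < n := by omega
  have hn' : (0 : ℝ) < n := by exact_mod_cast hn
  have h1 : 0 < rzTh n k := by unfold rzTh; positivity
  have h2 : rzTh n k < 2 * Real.pi := by
    unfold rzTh
    rw [div_lt_iff₀ (by positivity)]
    have : (k : ℝ) + 1 ≤ 2 * n := by exact_mod_cast hk
    nlinarith [Real.pi_pos]
  have h3 : Real.cos (rzTh n k) ≠ 1 := by
    intro h
    rw [Real.cos_eq_one_iff_of_lt_of_lt (by linarith [Real.pi_pos]) h2] at h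
    linarith
  have := Real.cos_le_one (rzTh n k)
  exact sub_pos.2 (lt_of_le_of_ne this h3)

lemma rz_sin {n : ℕ} (hn : 0 < n) (k : ℕ) : Real.sin (n * rzTh n k) = (-1) ^ k := by
  have hn' : (0 : ℝ) < n := by exact_mod_cast hn
  have : n * rzTh n k = Real.pi / 2 + k * Real.pi := by unfold rzTh; field_simp; ring
  rw [this, Real.sin_add_nat_mul_pi]; simp

lemma rz_cos {n : ℕ} (hn : 0 < n) (k : ℕ) : Real.cos (n * rzTh n k) = 0 := by
  have hn' : (0 : ℝ) < n := by exact_mod_cast hn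
  have : n * rzTh n k = Real.pi / 2 + k * Real.pi := by unfold rzTh; field_simp; ring
  rw [this, Real.cos_add_nat_mul_pi]; simp

/-- cosine sums vanish -/
lemma rz_C {n : ℕ} (hn : 0 < n) (m : ℕ) :
    ∑ k ∈ Finset.range (2 * n), rzW n k * Real.cos (m * rzTh n k) = 0 := by
  have hn' : (0 : ℝ) < n := by exact_mod_cast hn
  have h := Finset.sum_range_reflect (fun k => rzW n k * Real.cos (m * rzTh n k)) (2 * n)
  have h2 : ∑ k ∈ Finset.range (2 * n), rzW n (2 * n - 1 - k) * Real.cos (m * rzTh n (2 * n - 1 - k))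
      = ∑ k ∈ Finset.range (2 * n), -(rzW n k * Real.cos (m * rzTh n k)) := by
    refine Finset.sum_congr rfl fun k hk => ?_
    have hk := Finset.mem_range.1 hk
    obtain ⟨j, hj⟩ : ∃ j, 2 * n - 1 - k = j := ⟨_, rfl⟩
    have hjk : j + k + 1 = 2 * n := by omega
    have hjk' : (j : ℝ) + k + 1 = 2 * n := by exact_mod_cast hjk
    rw [hj]
    have ht : rzTh n j = 2 * Real.pi - rzTh n k := by
      unfold rzTh
      have : (j : ℝ) = 2 * n - k - 1 := by linarith
      rw [this]; field_simp; ring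
    have hs : (-1 : ℝ) ^ j = -(-1) ^ k := by
      have h1 : (-1 : ℝ) ^ (j + k + 1) = 1 := by rw [hjk]; simp
      have h2 : (-1 : ℝ) ^ k * (-1) ^ k = 1 := by rw [← mul_pow]; simp
      rw [pow_succ, pow_add] at h1
      linear_combination (-(-1) ^ k) * h1 - (-1 : ℝ) ^ j * h2
    have hc : Real.cos (m * rzTh n j) = Real.cos (m * rzTh n k) := by
      rw [ht, mul_sub, ← Real.cos_nat_mul_two_pi_sub (m * rzTh n k) m]
    have hc1 : Real.cos (rzTh n j) = Real.cos (rzTh n k) := by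
      rw [ht, Real.cos_two_pi_sub]
    rw [hc, rzW, rzW, hc1, hs]; ring
  rw [h2, Finset.sum_neg_distrib] at h
  linarith

lemma rz_G {n m : ℕ} (hm : m < n) :
    ∑ k ∈ Finset.range (2 * n), (-1) ^ k * Real.sin (m * rzTh n k) = 0 := by
  have hn : 0 < n := by omega
  have hn' : (0 : ℝ) < n := by exact_mod_cast hn
  set φ : ℝ := m * Real.pi / (2 * n) with hφ
  have hcos : 0 < Real.cos φ := by
    apply Real.cos_pos_of_mem_Ioo
    have : (m : ℝ) < n := by exact_mod_cast hm
    constructor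
    · have : 0 ≤ φ := by positivity
      linarith [Real.pi_pos]
    · rw [hφ, div_lt_iff₀ (by positivity)]
      nlinarith [Real.pi_pos]
  have key : ∀ N : ℕ, (∑ k ∈ Finset.range N, (-1) ^ k * Real.sin (m * rzTh n k)) * (2 * Real.cos φ)
      = -(-1) ^ N * Real.sin (2 * N * φ) := by
    intro N
    induction N with
    | zero => simp
    | succ N ih =>
      rw [Finset.sum_range_succ, add_mul, ih]
      have e : (m : ℝ) * rzTh n N = 2 * N * φ + φ := by rw [hφ]; unfold rzTh; field_simp
      have e2 : (2 : ℝ) * ((N + 1 : ℕ) : ℝ) * φ = 2 * N * φ + 2 * φ := by push_cast; ring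
      rw [e, e2, Real.sin_add, Real.sin_add, Real.sin_two_mul, Real.cos_two_mul, pow_succ]
      have := Real.sin_sq_add_cos_sq φ
      ring
  have := key (2 * n)
  have e : (2 : ℝ) * ((2 * n : ℕ) : ℝ) * φ = m * (2 * Real.pi) := by
    rw [hφ]; push_cast; field_simp
  have e3 : Real.sin (m * (2 * Real.pi)) = 0 := by
    have := Real.sin_nat_mul_pi (2 * m)
    rw [← this]; push_cast; ring_nf
  rw [e, e3, mul_zero] at this
  rcases mul_eq_zero.1 this with h | h
  · exact h
  · linarith

lemma rz_diff {n : ℕ} (hn : 0 < n) (m : ℕ) :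
    ∑ k ∈ Finset.range (2 * n), rzW n k * Real.sin ((m + 2 : ℕ) * rzTh n k)
    + ∑ k ∈ Finset.range (2 * n), rzW n k * Real.sin (m * rzTh n k)
    - 2 * ∑ k ∈ Finset.range (2 * n), rzW n k * Real.sin ((m + 1 : ℕ) * rzTh n k)
    = -(1 / n) * ∑ k ∈ Finset.range (2 * n), (-1) ^ k * Real.sin ((m + 1 : ℕ) * rzTh n k) := by
  have hn' : (0 : ℝ) < n := by exact_mod_cast hn
  rw [Finset.mul_sum, Finset.mul_sum, ← Finset.sum_add_distrib, ← Finset.sum_sub_distrib]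
  refine Finset.sum_congr rfl fun k hk => ?_
  have hp := rz_pos (Finset.mem_range.1 hk)
  have e1 : ((m + 2 : ℕ) : ℝ) * rzTh n k = (m + 1 : ℕ) * rzTh n k + rzTh n k := by push_cast; ring
  have e2 : ((m : ℕ) : ℝ) * rzTh n k = (m + 1 : ℕ) * rzTh n k - rzTh n k := by push_cast; ring
  rw [e1, e2, Real.sin_add, Real.sin_sub, rzW]
  have := hp.ne'
  field_simp
  ring

lemma rz_S {n : ℕ} (hn : 0 < n) :
    ∀ m ≤ n, ∑ k ∈ Finset.range (2 * n), rzW n k * Real.sin (m * rzTh n k) = m := by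
  have hn' : (0 : ℝ) < n := by exact_mod_cast hn
  set S : ℕ → ℝ := fun m => ∑ k ∈ Finset.range (2 * n), rzW n k * Real.sin (m * rzTh n k) with hS
  have h0 : S 0 = 0 := by simp [hS]
  have hd : ∀ m, m + 1 < n → S (m + 2) + S m - 2 * S (m + 1) = 0 := by
    intro m hm
    have := rz_diff hn m
    rw [rz_G hm, mul_zero] at this
    exact this
  have hlin : ∀ m, (m ≤ n → S m = m * S 1) ∧ (m + 1 ≤ n → S (m + 1) = (m + 1) * S 1) := by
    intro m
    induction m with
    | zero => simp [h0]
    | succ m ih =>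
      refine ⟨fun h => by rw [ih.2 h]; push_cast; ring, fun h => ?_⟩
      have := hd m (by omega)
      rw [ih.1 (by omega), ih.2 (by omega)] at this
      push_cast
      show S (m + 2) = _
      linarith
  obtain ⟨l, rfl⟩ : ∃ l, n = l + 1 := ⟨n - 1, by omega⟩
  have hlast : S (l + 2) + S l - 2 * S (l + 1) = -2 := by
    have := rz_diff hn l
    rw [show ∑ k ∈ Finset.range (2 * (l+1)), (-1) ^ k * Real.sin ((l + 1 : ℕ) * rzTh (l+1) k)
        = 2 * ((l + 1 : ℕ) : ℝ) from ?_] at this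
    · rw [show S (l+2) + S l - 2 * S (l+1) = _ from this]
      field_simp
    · rw [Finset.sum_congr rfl (g := fun _ => (1 : ℝ))]
      · simp
      · intro k _
        rw [rz_sin hn, ← mul_pow]; simp
  have hsym : S (l + 2) = S l := by
    refine Finset.sum_congr rfl fun k hk => ?_
    have e1 : ((l + 2 : ℕ) : ℝ) * rzTh (l+1) k = (l + 1 : ℕ) * rzTh (l+1) k + rzTh (l+1) k := by push_cast; ring
    have e2 : ((l : ℕ) : ℝ) * rzTh (l+1) k = (l + 1 : ℕ) * rzTh (l+1) k - rzTh (l+1) k := by push_cast; ring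
    rw [e1, e2, Real.sin_add, Real.sin_sub, rz_cos hn]; ring
  have a1 := (hlin l).1 (by omega)
  have a2 := (hlin l).2 (by omega)
  have hS1 : S 1 = 1 := by rw [hsym, a1, a2] at hlast; linarith
  intro m hm
  have := (hlin m).1 hm
  rw [hS1, mul_one] at this
  exact this

lemma rz_abs {n : ℕ} (hn : 0 < n) : ∑ k ∈ Finset.range (2 * n), |rzW n k| = n := by
  rw [← rz_S hn n le_rfl]
  refine Finset.sum_congr rfl fun k hk => ?_
  have hp := rz_pos (Finset.mem_range.1 hk)
  rw [rz_sin hn, rzW, abs_div, abs_pow, abs_neg, abs_one, one_pow, abs_of_nonneg (by positivity),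
    div_mul_eq_mul_div, ← mul_pow]
  simp

/-- Riesz interpolation formula. -/
lemma rz_formula {n : ℕ} (hn : 0 < n) (θ : ℝ) :
    ∀ m ≤ n, ∀ P : ℝ[X], P.natDegree ≤ m →
      P.derivative.eval (Real.cos θ) * Real.sin θ
        = -∑ k ∈ Finset.range (2 * n), rzW n k * P.eval (Real.cos (θ + rzTh n k)) := by
  have hT : ∀ m : ℕ, m ≤ n → (Chebyshev.T ℝ m).derivative.eval (Real.cos θ) * Real.sin θ
        = -∑ k ∈ Finset.range (2 * n), rzW n k * (Chebyshev.T ℝ m).eval (Real.cos (θ + rzTh n k)) := by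
    intro m hm
    have h1 : (Chebyshev.T ℝ m).derivative.eval (Real.cos θ) * Real.sin θ = m * Real.sin (m * θ) := by
      rw [Chebyshev.T_derivative_eq_U, eval_mul, mul_assoc, Chebyshev.U_real_cos]
      simp
    have h2 : ∑ k ∈ Finset.range (2 * n), rzW n k * (Chebyshev.T ℝ m).eval (Real.cos (θ + rzTh n k))
        = Real.cos (m * θ) * ∑ k ∈ Finset.range (2 * n), rzW n k * Real.cos (m * rzTh n k)
          - Real.sin (m * θ) * ∑ k ∈ Finset.range (2 * n), rzW n k * Real.sin (m * rzTh n k) := by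
      rw [Finset.mul_sum, Finset.mul_sum, ← Finset.sum_sub_distrib]
      refine Finset.sum_congr rfl fun k _ => ?_
      rw [Chebyshev.T_real_cos, Int.cast_natCast, mul_add, Real.cos_add]
      ring
    rw [h1, h2, rz_C hn, rz_S hn m hm]; ring
  intro m
  induction m with
  | zero =>
    intro _ P hP
    obtain ⟨c, rfl⟩ := natDegree_eq_zero.1 (Nat.le_zero.1 hP)
    have := rz_C hn 0
    simp only [Nat.cast_zero, zero_mul, Real.cos_zero, mul_one] at this
    simp [← Finset.sum_mul, this]
  | succ m ih =>
    intro hm P hP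
    set T := Chebyshev.T ℝ ((m + 1 : ℕ) : ℤ) with hTdef
    have hTd : T.natDegree = m + 1 := by rw [hTdef, Chebyshev.natDegree_T]; exact Int.natAbs_natCast _
    have hT0 : T.coeff (m + 1) ≠ 0 := by
      rw [← hTd]; exact leadingCoeff_ne_zero.2 (Chebyshev.T_ne_zero ℝ _)
    set c := P.coeff (m + 1) / T.coeff (m + 1) with hc
    have hQ : (P - C c * T).natDegree ≤ m := by
      rw [natDegree_le_iff_coeff_eq_zero]
      intro N hN
      rcases Nat.lt_or_ge (m + 1) N with h | h
      · rw [coeff_sub, coeff_C_mul, coeff_eq_zero_of_natDegree_lt (by omega),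
          coeff_eq_zero_of_natDegree_lt (by omega)]; simp
      · have : N = m + 1 := by omega
        rw [this, coeff_sub, coeff_C_mul, hc]; field_simp; ring
    have h1 := ih (by omega) _ hQ
    have h2 := hT (m + 1) hm
    rw [← hTdef] at h2
    simp only [derivative_sub, derivative_mul, derivative_C, zero_mul, zero_add, eval_sub, eval_mul,
      eval_C, mul_sub, Finset.sum_sub_distrib] at h1
    have h3 : ∑ k ∈ Finset.range (2 * n), rzW n k * (c * T.eval (Real.cos (θ + rzTh n k)))
      = c * ∑ k ∈ Finset.range (2 * n), rzW n k * T.eval (Real.cos (θ + rzTh n k)) := by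
      rw [Finset.mul_sum]; exact Finset.sum_congr rfl fun k _ => by ring
    rw [h3] at h1
    linear_combination h1 + c * h2

lemma bernstein_cos {n : ℕ} (hn : 0 < n) (P : ℝ[X]) (hP : P.natDegree ≤ n)
    (hb : ∀ x ∈ Set.Icc (-1 : ℝ) 1, |P.eval x| ≤ 1) (θ : ℝ) :
    |P.derivative.eval (Real.cos θ) * Real.sin θ| ≤ n := by
  rw [rz_formula hn θ n le_rfl P hP, abs_neg, ← rz_abs hn]
  refine (Finset.abs_sum_le_sum_abs _ _).trans (Finset.sum_le_sum fun k _ => ?_)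
  rw [abs_mul]
  exact mul_le_of_le_one_right (abs_nonneg _) (hb _ ⟨Real.neg_one_le_cos _, Real.cos_le_one _⟩)

/-- Schur step near the right end point. -/
lemma schur_right {n : ℕ} (hn : 0 < n) (P : ℝ[X]) (hP : P.natDegree ≤ n)
    (hb : ∀ x ∈ Set.Icc (-1 : ℝ) 1, |P.eval x| ≤ 1) (x : ℝ) (hx1 : x ≤ 1)
    (hx : Real.cos (Real.pi / (2 * n)) < x) :
    |P.derivative.eval x| ≤ (n : ℝ) ^ 2 := by
  classical
  have hn' : (0 : ℝ) < n := by exact_mod_cast hn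
  set T := Chebyshev.T ℝ (n : ℤ) with hT
  set s : Finset ℝ := (Finset.range n).image (fun (k : ℕ) => Real.cos ((2 * k + 1) * Real.pi / (2 * n))) with hs
  have hroots : T.roots = s.val := Chebyshev.roots_T_real n
  have hTd : T.natDegree = n := by rw [hT, Chebyshev.natDegree_T]; simp
  have hcard : s.card = n := by
    have h := Chebyshev.roots_T_real_nodup n
    have h' := (Finset.range n).nodup_map_iff_injOn.mp h
    rw [hs, Finset.card_image_of_injOn h', Finset.card_range]
  have hT0 : T ≠ 0 := Chebyshev.T_ne_zero ℝ _
  set c := T.leadingCoeff with hc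
  have hc0 : c ≠ 0 := leadingCoeff_ne_zero.2 hT0
  have hTn : T = C c * Lagrange.nodal s id := by
    have := C_leadingCoeff_mul_prod_multiset_X_sub_C (p := T) (by rw [hroots, hTd]; exact hcard)
    rw [hroots] at this
    rw [Lagrange.nodal_eq]
    exact this.symm
  have hlt : ∀ y ∈ s, y < x := by
    intro y hy
    obtain ⟨k, hk, rfl⟩ := Finset.mem_image.1 hy
    have hk := Finset.mem_range.1 hk
    refine lt_of_le_of_lt ?_ hx
    have hk' : (k : ℝ) + 1 ≤ n := by exact_mod_cast hk
    apply Real.cos_le_cos_of_nonneg_of_le_pi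
    · positivity
    · rw [div_le_iff₀ (by positivity)]; nlinarith [Real.pi_pos]
    · gcongr
      have : (0 : ℝ) ≤ k := by positivity
      nlinarith [Real.pi_pos]
  -- node bounds
  have hnode : ∀ y ∈ s, |Lagrange.nodalWeight s id y * P.derivative.eval y| ≤ |c| := by
    intro y hy
    have hw := Lagrange.nodalWeight_eq_eval_derivative_nodal (v := (id : ℝ → ℝ)) hy
    obtain ⟨k, hk, hyk⟩ := Finset.mem_image.1 hy
    have h1 := bernstein_cos hn P hP hb ((2 * k + 1) * Real.pi / (2 * n))
    have h2 : T.derivative.eval (Real.cos ((2 * k + 1) * Real.pi / (2 * n)))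
        * Real.sin ((2 * k + 1) * Real.pi / (2 * n)) = n * (-1) ^ k := by
      rw [hT, Chebyshev.T_derivative_eq_U, eval_mul, mul_assoc, Chebyshev.U_real_cos, ← rz_sin hn k]
      simp [rzTh]
    rw [hyk] at h1 h2
    set σ := Real.sin ((2 * k + 1) * Real.pi / (2 * n)) with hσ
    have h3 : T.derivative.eval y = c * (Lagrange.nodal s id).derivative.eval y := by
      conv_lhs => rw [hTn]
      simp
    rw [h3] at h2
    have h4 : |c| * |(Lagrange.nodal s id).derivative.eval y| * |σ| = n := by
      rw [← abs_mul, ← abs_mul, h2]; simp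
    have hpos : 0 < |(Lagrange.nodal s id).derivative.eval y| := by
      rw [abs_pos]; rintro h; rw [h] at h4; simp at h4; exact hn'.ne h4
    have hσ0 : 0 < |σ| := by
      rw [abs_pos]; rintro h; rw [h] at h4; simp at h4; exact hn'.ne h4
    rw [hw, abs_mul, abs_inv, id, inv_mul_le_iff₀ hpos]
    rw [abs_mul] at h1
    refine le_of_mul_le_mul_right ?_ hσ0
    linarith
  have hN : 0 < (Lagrange.nodal s id).eval x := by
    rw [Lagrange.eval_nodal]
    exact Finset.prod_pos fun y hy => sub_pos.2 (hlt y hy)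
  have hder : (Lagrange.nodal s id).derivative.eval x
      = (Lagrange.nodal s id).eval x * ∑ y ∈ s, (x - y)⁻¹ := by
    rw [Lagrange.derivative_nodal, eval_finsetSum, Finset.mul_sum]
    refine Finset.sum_congr rfl fun y hy => ?_
    rw [Lagrange.nodal_eq_mul_nodal_erase hy]
    have : x - y ≠ 0 := (sub_pos.2 (hlt y hy)).ne'
    simp; field_simp
  have hint : P.derivative.eval x = (Lagrange.nodal s id).eval x *
      ∑ y ∈ s, Lagrange.nodalWeight s id y * (x - y)⁻¹ * P.derivative.eval y := by
    have hdeg : P.derivative.degree < s.card := by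
      rw [hcard]
      refine lt_of_le_of_lt degree_le_natDegree ?_
      have := natDegree_derivative_le P
      exact_mod_cast (by omega : P.derivative.natDegree < n)
    have h1 := Lagrange.eq_interpolate (v := (id : ℝ → ℝ)) (Set.injOn_id _) hdeg
    conv_lhs => rw [h1]
    rw [Lagrange.eval_interpolate_not_at_node]
    · rfl
    · intro y hy; exact (hlt y hy).ne'
  have hmain : |P.derivative.eval x| ≤ |T.derivative.eval x| := by
    have h3 : T.derivative.eval x = c * (Lagrange.nodal s id).derivative.eval x := by
      conv_lhs => rw [hTn]
      simp
    rw [h3, hder, hint, abs_mul, abs_mul, abs_mul, abs_of_pos hN, mul_left_comm]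
    refine mul_le_mul_of_nonneg_left ?_ hN.le
    rw [abs_of_nonneg (Finset.sum_nonneg fun y hy => inv_nonneg.2 (sub_pos.2 (hlt y hy)).le), Finset.mul_sum]
    refine (Finset.abs_sum_le_sum_abs _ _).trans (Finset.sum_le_sum fun y hy => ?_)
    have hp := inv_nonneg.2 (sub_pos.2 (hlt y hy)).le
    rw [mul_right_comm, abs_mul, abs_of_nonneg hp]
    exact mul_le_mul_of_nonneg_right (hnode y hy) hp
  have hx0 : -1 ≤ x := (Real.neg_one_le_cos _).trans hx.le
  have h5 := Chebyshev.abs_iterate_derivative_T_real_le (n : ℤ) 1 (x := x) (abs_le.2 ⟨hx0, hx1⟩)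
  simp only [Function.iterate_one] at h5
  rw [Chebyshev.derivative_T_eval_one] at h5
  refine hmain.trans (h5.trans_eq ?_)
  simp

lemma markov_ineq {n : ℕ} (hn : 0 < n) (P : ℝ[X]) (hP : P.natDegree ≤ n)
    (hb : ∀ x ∈ Set.Icc (-1 : ℝ) 1, |P.eval x| ≤ 1) (x : ℝ) (hx : x ∈ Set.Icc (-1 : ℝ) 1) :
    |P.derivative.eval x| ≤ (n : ℝ) ^ 2 := by
  have hn' : (0 : ℝ) < n := by exact_mod_cast hn
  have hn1 : (1 : ℝ) ≤ n := by exact_mod_cast hn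
  rcases lt_or_ge (Real.cos (Real.pi / (2 * n))) x with h | h
  · exact schur_right hn P hP hb x hx.2 h
  rcases lt_or_ge (Real.cos (Real.pi / (2 * n))) (-x) with h' | h'
  · have := schur_right hn (P.comp (-X)) (by rw [natDegree_comp]; simpa using hP)
      (fun y hy => by
        rw [eval_comp]; simp only [eval_neg, eval_X]
        exact hb _ ⟨by linarith [hy.2], by linarith [hy.1]⟩) (-x) (by linarith [hx.1]) h'
    simpa [derivative_comp] using this
  · have h1 := bernstein_cos hn P hP hb (Real.arccos x)
    rw [Real.cos_arccos hx.1 hx.2, Real.sin_arccos, abs_mul, abs_of_nonneg (Real.sqrt_nonneg _)] at h1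
    have h2 : 1 / (n : ℝ) ≤ Real.sin (Real.pi / (2 * n)) := by
      have := Real.mul_le_sin (x := Real.pi / (2 * n)) (by positivity) (by gcongr; linarith)
      refine le_trans (le_of_eq ?_) this
      have := Real.pi_pos
      field_simp
    have h3 : 1 / (n : ℝ) ≤ √(1 - x ^ 2) := by
      apply Real.le_sqrt_of_sq_le
      have h4 := Real.sin_sq_add_cos_sq (Real.pi / (2 * n))
      have h5 : x ^ 2 ≤ Real.cos (Real.pi / (2 * n)) ^ 2 := sq_le_sq' (by linarith) h
      have h6 : (1 / (n : ℝ)) ^ 2 ≤ Real.sin (Real.pi / (2 * n)) ^ 2 := by gcongr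
      linarith
    have h4 : |P.derivative.eval x| * (1 / n) ≤ n :=
      (mul_le_mul_of_nonneg_left h3 (abs_nonneg _)).trans h1
    rw [mul_one_div, div_le_iff₀ hn'] at h4
    linarith [sq (n : ℝ)]

theorem polynomial_threshold_degree_lower_bound
    (p : Polynomial ℝ) (a b : ℝ) (ha : 0 ≤ a) (hab : a < b) (hb : b ≤ 1)
    (hbound : ∀ x ∈ Set.Icc (0 : ℝ) 1, p.eval x ∈ Set.Icc (0 : ℝ) 1)
    (hpa : p.eval a ≤ 1 / 3) (hpb : 2 / 3 ≤ p.eval b) :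
    1 / (3 * (b - a)) ≤ (p.natDegree : ℝ) ^ 2 ∧
      ∀ Δ t : ℝ, 0 < Δ → Δ < 1 → 0 < t → t < 1 →
        a = Δ * (1 - t) → b = Δ * (1 + t) →
        Real.sqrt (1 / (6 * Δ * t)) ≤ (p.natDegree : ℝ) := by
  have key : 1 / (3 * (b - a)) ≤ (p.natDegree : ℝ) ^ 2 := by
    have hd : 0 < p.natDegree := by
      rw [Nat.pos_iff_ne_zero]
      intro h
      obtain ⟨c, rfl⟩ := natDegree_eq_zero.1 h
      simp only [eval_C] at hpa hpb
      linarith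
    set q : ℝ[X] := C 2 * p.comp (C (1 / 2) * X + C (1 / 2)) - C 1 with hq
    have hqe : ∀ y, q.eval y = 2 * p.eval (1 / 2 * y + 1 / 2) - 1 := by
      intro y; simp [hq, eval_comp]
    have hqd : q.natDegree ≤ p.natDegree := by
      have h1 : (C (1 / 2 : ℝ) * X + C (1 / 2)).natDegree ≤ 1 := natDegree_linear_le
      rw [hq, natDegree_sub_C]
      refine (natDegree_C_mul_le _ _).trans (natDegree_comp_le.trans ?_)
      exact (Nat.mul_le_mul_left _ h1).trans (by simp)
    have hqder : ∀ y, q.derivative.eval y = p.derivative.eval (1 / 2 * y + 1 / 2) := by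
      intro y
      simp [hq, derivative_comp, eval_comp]
    have hqb : ∀ y ∈ Set.Icc (-1 : ℝ) 1, |q.eval y| ≤ 1 := by
      intro y hy
      have := hbound (1 / 2 * y + 1 / 2) ⟨by linarith [hy.1], by linarith [hy.2]⟩
      rw [hqe, abs_le]
      constructor <;> linarith [this.1, this.2]
    obtain ⟨ξ, hξ, hξe⟩ := exists_deriv_eq_slope (fun x => p.eval x) hab p.continuous.continuousOn
      p.differentiable.differentiableOn
    have hm := markov_ineq hd q hqd hqb (2 * ξ - 1)
      ⟨by linarith [hξ.1], by linarith [hξ.2]⟩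
    rw [hqder, show (1 / 2 : ℝ) * (2 * ξ - 1) + 1 / 2 = ξ by ring] at hm
    rw [Polynomial.deriv] at hξe
    have hba : 0 < b - a := sub_pos.2 hab
    refine le_trans ?_ ((le_abs_self _).trans hm)
    rw [hξe, ← div_div]
    gcongr
    linarith
  refine ⟨key, ?_⟩
  intro Δ t hΔ _ ht _ h1 h2
  apply Real.sqrt_le_iff.2 ⟨by positivity, ?_⟩
  rwa [show 6 * Δ * t = 3 * (b - a) by rw [h1, h2]; ring]
end
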